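/- arXiv:1105.2525 — 6 statements merged into one kernel-verified Lean document; each statement's English description precedes it below -/
import Mathlib

section
/- Fix a real constant c' < 3/2. For each n ≥ 2 let m = m(n) be a nonnegative integer with m ≤ c'·n, and let F_n be a random 2-iSAT formula on n variables with m clauses, where the m clauses are chosen independently and each clause consists of an unordered pair of two distinct variables chosen uniformly at random from the n variables, together with, for each of its two literals, an independent random interval. Then the probability that F_n has a satisfying interpretation tends to 1 as n → ∞. -/
open MeasureTheory

/-- A signed literal `x ∈ I` where `I = [lo, hi]` is a nonempty closed subinterval
of `[0,1]`. -/
structure ISatLiteral (V : Type*) where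
  var : V
  lo : ℝ
  hi : ℝ
  lo_le_hi : lo ≤ hi
  lo_nonneg : 0 ≤ lo
  hi_le_one : hi ≤ 1

/-- The interval (sign) of a literal. -/
def ISatLiteral.interval {V : Type*} (L : ISatLiteral V) : Set ℝ := Set.Icc L.lo L.hi

/-- A 2-clause: a pair of two literals. -/
abbrev ISatClause (V : Type*) := ISatLiteral V × ISatLiteral V

/-- A 2-iSAT formula: a finite list of 2-clauses. -/
abbrev ISatFormula (V : Type*) := List (ISatClause V)

/-- An interpretation `v : V → [0,1]` satisfies `F` if every clause contains a
literal `(x, I)` with `v(x) ∈ I`. -/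
def ISatFormula.Satisfies {V : Type*} (F : ISatFormula V) (v : V → ℝ) : Prop :=
  (∀ x : V, v x ∈ Set.Icc (0 : ℝ) 1) ∧
  ∀ c ∈ F, v c.1.var ∈ c.1.interval ∨ v c.2.var ∈ c.2.interval

/-- Clamping a real number into `[0,1]` (the randomness lives a.s. in `[0,1]` anyway). -/
noncomputable def clamp01 (t : ℝ) : ℝ := max 0 (min t 1)

/-- The random literal on variable `x` built from the two endpoint samples `u, v`:
its interval is `[min(u,v), max(u,v)]` (after clamping into `[0,1]`). -/
noncomputable def mkLiteral {V : Type*} (x : V) (u v : ℝ) : ISatLiteral V where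
  var := x
  lo := min (clamp01 u) (clamp01 v)
  hi := max (clamp01 u) (clamp01 v)
  lo_le_hi := min_le_max
  lo_nonneg := le_min (le_max_left 0 _) (le_max_left 0 _)
  hi_le_one := max_le (max_le zero_le_one (min_le_right _ _))
    (max_le zero_le_one (min_le_right _ _))

/-- Unordered pairs of distinct variables, encoded as ordered pairs of distinct
variables (choosing one uniformly at random and forgetting the order yields the
uniform unordered pair of two distinct variables). -/
abbrev VarPair (n : ℕ) := {p : Fin n × Fin n // p.1 ≠ p.2}

/-- The uniform probability measure on a finite type. -/
noncomputable def uniformMeasure (α : Type*) [Fintype α] [MeasurableSpace α] :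
    Measure α := (Fintype.card α : ENNReal)⁻¹ • Measure.count

/-- Sample space for a single random clause: a uniformly random pair of two distinct
variables together with four independent uniform samples from `[0,1]` (the endpoints
of the two independent random intervals). -/
abbrev ClauseSample (n : ℕ) := VarPair n × (Fin 4 → ℝ)

/-- The distribution of a single random clause sample. -/
noncomputable def clauseSampleMeasure (n : ℕ) : Measure (ClauseSample n) :=
  (uniformMeasure (VarPair n)).prod (Measure.pi fun _ => volume.restrict (Set.Icc 0 1))

/-- The distribution of `m` independent random clause samples. -/
noncomputable def formulaSampleMeasure (n m : ℕ) : Measure (Fin m → ClauseSample n) :=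
  Measure.pi fun _ => clauseSampleMeasure n

/-- The random 2-iSAT formula built from `m` clause samples: the `i`-th clause consists
of the two variables of the `i`-th sampled pair, each with its own random interval. -/
noncomputable def randomFormula (n m : ℕ) (ω : Fin m → ClauseSample n) :
    ISatFormula (Fin n) :=
  List.ofFn fun i : Fin m =>
    (mkLiteral (ω i).1.val.1 ((ω i).2 0) ((ω i).2 1),
     mkLiteral (ω i).1.val.2 ((ω i).2 2) ((ω i).2 3))

open scoped ENNReal

def dbar {ι : Type*} (d : ι × Bool) : ι × Bool := (d.1, !d.2)

lemma dbar_dbar {ι : Type*} (d : ι × Bool) : dbar (dbar d) = d := by simp [dbar]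

lemma dbar_fst {ι : Type*} (d : ι × Bool) : (dbar d).1 = d.1 := rfl

lemma eq_or_dbar {ι : Type*} {a b : ι × Bool} (h : a.1 = b.1) : a = b ∨ a = dbar b := by
  obtain ⟨i, s⟩ := a
  obtain ⟨j, t⟩ := b
  simp only at h
  subst h
  cases s <;> cases t <;> simp [dbar]

def Arr {ι : Type*} (R : ι × Bool → ι × Bool → Prop) (a b : ι × Bool) : Prop := R a (dbar b)

lemma reach_contra {ι : Type*} {R : ι × Bool → ι × Bool → Prop} (hs : ∀ a b, R a b → R b a)
    {a b : ι × Bool} (h : Relation.ReflTransGen (Arr R) a b) :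
    Relation.ReflTransGen (Arr R) (dbar b) (dbar a) := by
  induction h with
  | refl => exact .refl
  | tail _ hbc ih =>
    refine Relation.ReflTransGen.head ?_ ih
    unfold Arr at *
    rw [dbar_dbar]
    exact hs _ _ hbc

/-- 2-SAT criterion. -/
lemma two_sat {ι : Type*} [Finite ι] {R : ι × Bool → ι × Bool → Prop}
    (hs : ∀ a b, R a b → R b a)
    (h : ∀ i, ∃ s, ¬ Relation.ReflTransGen (Arr R) (i, s) (dbar (i, s))) :
    ∃ s : ι → Bool, ∀ i j, ¬ R (i, s i) (j, s j) := by
  classical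
  let P : Set (Set (ι × Bool)) :=
    {T | (∀ a ∈ T, ∀ b, Arr R a b → b ∈ T) ∧ ∀ a ∈ T, dbar a ∉ T}
  have hfin : P.Finite := Set.toFinite _
  have hne : P.Nonempty := ⟨∅, by simp [P]⟩
  obtain ⟨T, hT⟩ := hfin.exists_maximal hne
  obtain ⟨hcl, hcons⟩ := hT.prop
  have hclr : ∀ a ∈ T, ∀ b, Relation.ReflTransGen (Arr R) a b → b ∈ T := by
    intro a ha b hab
    induction hab with
    | refl => exact ha
    | tail _ hbc ih => exact hcl _ ih _ hbc
  have htot : ∀ i, ∃ s, (i, s) ∈ T := by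
    intro i
    by_contra! hi
    obtain ⟨s, hsn⟩ := h i
    have hT' : T ∪ {b | Relation.ReflTransGen (Arr R) (i, s) b} ∈ P := by
      have key : ∀ d ∈ T, ¬ Relation.ReflTransGen (Arr R) (i, s) (dbar d) := by
        intro d hd hr
        have := reach_contra hs hr
        rw [dbar_dbar] at this
        exact hi _ (hclr _ hd _ this)
      constructor
      · rintro a (ha | ha) b hab
        · exact Or.inl (hcl a ha b hab)
        · exact Or.inr (Relation.ReflTransGen.tail ha hab)
      · rintro a (ha | ha) (hb | hb)
        · exact hcons a ha hb
        · exact key a ha hb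
        · refine key _ hb ?_
          rw [dbar_dbar]; exact ha
        · have h2 := reach_contra hs hb
          rw [dbar_dbar] at h2
          exact hsn (Relation.ReflTransGen.trans ha h2)
    have := hT.le_of_ge hT' Set.subset_union_left
    exact hi s (this (Or.inr Relation.ReflTransGen.refl))
  choose s hsT using htot
  refine ⟨s, fun i j hR => ?_⟩
  have : dbar (j, s j) ∈ T := by
    apply hcl _ (hsT i)
    unfold Arr
    rw [dbar_dbar]; exact hR
  exact hcons _ (hsT j) this

def Lasso {ι : Type*} (R : ι × Bool → ι × Bool → Prop) (L : List (ι × Bool)) : Prop :=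
  L.IsChain (Arr R) ∧ (L.map Prod.fst).Nodup ∧ ∃ c ∈ L, ∃ b ∈ L.getLast?, R b c

def Bicycle {ι : Type*} (R : ι × Bool → ι × Bool → Prop) (L : List (ι × Bool)) : Prop :=
  Lasso R L ∧ ∃ d, d.1 ∈ L.map Prod.fst ∧ ∃ b ∈ L.head?, R d (dbar b)

lemma exists_lasso {ι : Type*} {R : ι × Bool → ι × Bool → Prop} {a b : ι × Bool}
    (h : Relation.ReflTransGen (Arr R) a b) :
    (∃ L, Lasso R L ∧ L.head? = some a) ∨
    ∃ L : List (ι × Bool), L.IsChain (Arr R) ∧ (L.map Prod.fst).Nodup ∧ L.head? = some a ∧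
      L.getLast? = some b := by
  induction h with
  | refl => exact Or.inr ⟨[a], by simp⟩
  | @tail b c _ hbc ih =>
    rcases ih with ih | ⟨L, hch, hnd, hh, hl⟩
    · exact Or.inl ih
    by_cases hc : c.1 ∈ L.map Prod.fst
    · obtain ⟨d, hd, hdc⟩ := List.mem_map.1 hc
      rcases eq_or_dbar hdc with rfl | rfl
      · right
        obtain ⟨L1, L2, rfl⟩ := List.append_of_mem hd
        refine ⟨L1 ++ [d], ?_, ?_, ?_, by simp⟩
        · have : L1 ++ d :: L2 = (L1 ++ [d]) ++ L2 := by simp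
          rw [this] at hch
          exact hch.left_of_append
        · have : L1 ++ d :: L2 = (L1 ++ [d]) ++ L2 := by simp
          rw [this, List.map_append] at hnd
          exact hnd.of_append_left
        · cases L1 <;> simpa using hh
      · left
        exact ⟨L, ⟨hch, hnd, dbar c, hd, b, by simp [hl], hbc⟩, hh⟩
    · right
      refine ⟨L ++ [c], ?_, ?_, ?_, by simp⟩
      · rw [List.isChain_append]
        refine ⟨hch, by simp, ?_⟩
        intro x hx y hy
        simp [hl] at hx hy
        subst hx; subst hy; exact hbc
      · rw [List.map_append, List.nodup_append]
        refine ⟨hnd, by simp, ?_⟩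
        intro x hx y hy
        simp at hy
        rintro rfl
        exact hc (hy ▸ hx)
      · cases L <;> simp_all

lemma extend_lasso {ι : Type*} {R : ι × Bool → ι × Bool → Prop} {a d : ι × Bool}
    (h : Relation.ReflTransGen (Arr R) d a) (L : List (ι × Bool)) (hL : Lasso R L)
    (ha : L.head? = some a) :
    (∃ L, Bicycle R L) ∨ ∃ L', Lasso R L' ∧ L'.head? = some d ∧ L ⊆ L' := by
  induction h using Relation.ReflTransGen.head_induction_on with
  | refl => exact Or.inr ⟨L, hL, ha, fun _ h => h⟩
  | @head e d hed _ ih =>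
    rcases ih with ih | ⟨L', hL', hh, hsub⟩
    · exact Or.inl ih
    by_cases he : e.1 ∈ L'.map Prod.fst
    · exact Or.inl ⟨L', hL', e, he, d, by simp [hh], hed⟩
    · right
      obtain ⟨h1, h2, c, hc, b, hb, hbc⟩ := hL'
      refine ⟨e :: L', ⟨?_, ?_, c, by simp [hc], b, ?_, hbc⟩, rfl, ?_⟩
      · rw [List.isChain_cons]
        refine ⟨?_, h1⟩
        intro y hy
        simp [hh] at hy
        subst hy; exact hed
      · rw [List.map_cons, List.nodup_cons]; exact ⟨he, h2⟩
      · cases L' <;> simp_all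
      · intro x hx
        exact List.mem_cons_of_mem _ (hsub hx)

lemma nodup_bar {ι : Type*} {L : List (ι × Bool)} (hnd : (L.map Prod.fst).Nodup) {a : ι × Bool}
    (ha : a ∈ L) (hb : dbar a ∈ L) : False := by
  have := List.inj_on_of_nodup_map hnd ha hb rfl
  obtain ⟨i, s⟩ := a
  cases s <;> simp [dbar] at this

lemma exists_bicycle {ι : Type*} [Finite ι] {R : ι × Bool → ι × Bool → Prop}
    (hs : ∀ a b, R a b → R b a)
    (h : ¬ ∃ s : ι → Bool, ∀ i j, ¬ R (i, s i) (j, s j)) : ∃ L, Bicycle R L := by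
  have h1 : ¬ ∀ i, ∃ s, ¬ Relation.ReflTransGen (Arr R) (i, s) (dbar (i, s)) :=
    fun h' => h (two_sat hs h')
  push Not at h1
  obtain ⟨i, hi⟩ := h1
  rcases exists_lasso (hi true) with ⟨L, hL, hh⟩ | ⟨L, _, hnd, hh, hl⟩
  · rcases extend_lasso (d := dbar (i, true)) (by simpa [dbar] using hi false) L hL hh with
      h | ⟨L', hL', hh', hsub⟩
    · exact h
    · exact (nodup_bar hL'.2.1 (hsub (List.mem_of_mem_head? hh)) (List.mem_of_mem_head? hh')).elim
  · exact (nodup_bar hnd (List.mem_of_mem_head? hh) (List.mem_of_mem_getLast? hl)).elim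

lemma chain_int {A B : Type*} [MeasurableSpace A] [MeasurableSpace B] (μ : Measure A)
    [IsProbabilityMeasure μ] (ν : Measure B) [IsProbabilityMeasure ν]
    (C : B → B → ℝ≥0∞) (hCm : Measurable (Function.uncurry C)) (α β : ℝ≥0∞)
    (hC : ∫⁻ y, ∫⁻ x, C x y ∂ν ∂ν ≤ β) (k : ℕ) :
    ∀ (V : Fin (k+1) → A → ℝ≥0∞) (p q : Fin (k+1) → A → B)
      (_ : ∀ l, Measurable (V l)) (_ : ∀ l, Measurable (p l)) (_ : ∀ l, Measurable (q l))
      (_ : ∀ l (f g : B → ℝ≥0∞), Measurable f → Measurable g →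
        ∫⁻ a, V l a * (f (p l a) * g (q l a)) ∂μ ≤ α * (∫⁻ x, f x ∂ν) * (∫⁻ x, g x ∂ν))
      (φ : B → ℝ≥0∞) (_ : Measurable φ),
      ∫⁻ ω, φ (p 0 (ω 0)) * ((∏ l, V l (ω l)) *
        ∏ l : Fin k, C (q l.castSucc (ω l.castSucc)) (p l.succ (ω l.succ)))
          ∂(Measure.pi fun _ : Fin (k+1) => μ) ≤ α ^ (k+1) * (∫⁻ x, φ x ∂ν) * β ^ k := by
  induction k with
  | zero =>
    intro V p q hV hp hq H φ hφ
    have h1 := H 0 φ (fun _ => 1) hφ measurable_const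
    have h2 : ∫⁻ ω : Fin 1 → A, φ (p 0 (ω 0)) * V 0 (ω 0) ∂(Measure.pi fun _ : Fin 1 => μ)
        = ∫⁻ a, φ (p 0 a) * V 0 a ∂μ := by
      exact (measurePreserving_eval (fun _ : Fin 1 => μ) 0).lintegral_comp
        (f := fun a => φ (p 0 a) * V 0 a) ((hφ.comp (hp 0)).mul (hV 0))
    simp only [mul_one, lintegral_const, measure_univ] at h1
    simp only [Fin.prod_univ_succ, Fin.prod_univ_zero, zero_add, pow_one, pow_zero, mul_one]
    refine (h2.trans ?_).trans_le h1
    simp_rw [mul_comm]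
  | succ k ih =>
    intro V p q hV hp hq H φ hφ
    let ψ : B → ℝ≥0∞ := fun y => ∫⁻ x, C x y ∂ν
    have hψ : Measurable ψ := hCm.lintegral_prod_left
    have hCs : ∀ y, Measurable fun x => C x y := fun y =>
      hCm.comp (measurable_id.prodMk measurable_const)
    let F : (Fin (k+1) → A) → ℝ≥0∞ := fun ω => (∏ l, V l.succ (ω l)) *
        ∏ l : Fin k, C (q l.succ.castSucc (ω l.castSucc)) (p l.succ.succ (ω l.succ))
    have hF : Measurable F := by
      refine Measurable.mul ?_ ?_
      · exact Finset.measurable_prod _ fun l _ => (hV _).comp (measurable_pi_apply _)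
      · refine Finset.measurable_prod _ fun l _ => ?_
        exact hCm.comp (((hq _).comp (measurable_pi_apply _)).prodMk
          ((hp _).comp (measurable_pi_apply _)))
    have IH := ih (fun l => V l.succ) (fun l => p l.succ) (fun l => q l.succ)
      (fun l => hV _) (fun l => hp _) (fun l => hq _) (fun l => H _) ψ hψ
    let G : A × (Fin (k+1) → A) → ℝ≥0∞ := fun z =>
      (V 0 z.1 * (φ (p 0 z.1) * C (q 0 z.1) (p 1 (z.2 0)))) * F z.2
    have hG : Measurable G := by
      refine Measurable.mul (Measurable.mul ((hV 0).comp measurable_fst)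
        (Measurable.mul (hφ.comp ((hp 0).comp measurable_fst)) ?_)) (hF.comp measurable_snd)
      exact hCm.comp (((hq _).comp measurable_fst).prodMk
          ((hp _).comp ((measurable_pi_apply _).comp measurable_snd)))
    have hmp := measurePreserving_piFinSuccAbove (fun _ : Fin (k+1+1) => μ) 0
    have e1 : ∫⁻ ω, φ (p 0 (ω 0)) * ((∏ l, V l (ω l)) *
        ∏ l : Fin (k+1), C (q l.castSucc (ω l.castSucc)) (p l.succ (ω l.succ)))
          ∂(Measure.pi fun _ : Fin (k+1+1) => μ) =
        ∫⁻ z, G z ∂(μ.prod (Measure.pi fun _ : Fin (k+1) => μ)) := by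
      rw [← hmp.lintegral_comp hG]
      refine lintegral_congr fun ω => ?_
      simp only [G, F]
      rw [Fin.prod_univ_succ (fun l => V l (ω l)), Fin.prod_univ_succ (fun l : Fin (k+1) =>
        C (q l.castSucc (ω l.castSucc)) (p l.succ (ω l.succ)))]
      simp [MeasurableEquiv.piFinSuccAbove, Fin.insertNthEquiv, Fin.tail]
      ring
    rw [e1, lintegral_prod_symm' _ hG]
    calc ∫⁻ y, ∫⁻ x, G (x, y) ∂μ ∂(Measure.pi fun _ : Fin (k+1) => μ)
        ≤ ∫⁻ y, (α * (∫⁻ x, φ x ∂ν)) * (ψ (p 1 (y 0)) * F y) ∂(Measure.pi fun _ => μ) := by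
          refine lintegral_mono fun y => ?_
          simp only [G]
          rw [lintegral_mul_const _ (by
            refine Measurable.mul (hV 0) (Measurable.mul (hφ.comp (hp 0))
              ((hCs _).comp (hq 0))))]
          refine (mul_le_mul' (H 0 φ (fun x => C x (p 1 (y 0))) hφ (hCs _)) le_rfl).trans
            (le_of_eq ?_)
          simp only [ψ]
          ring
      _ = (α * (∫⁻ x, φ x ∂ν)) * ∫⁻ y, ψ (p 1 (y 0)) * F y ∂(Measure.pi fun _ => μ) := by
          rw [lintegral_const_mul]
          exact (hψ.comp ((hp 1).comp (measurable_pi_apply _))).mul hF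
      _ ≤ (α * (∫⁻ x, φ x ∂ν)) * (α ^ (k+1) * β * β ^ k) := by
          gcongr
          refine IH.trans ?_
          gcongr
      _ = _ := by ring

noncomputable abbrev lam : Measure ℝ := volume.restrict (Set.Icc 0 1)

instance : IsProbabilityMeasure lam := ⟨by simp⟩

lemma pair_law (i j k l : Fin 4) (hij : i ≠ j) (hik : i ≠ k) (hil : i ≠ l) (hjk : j ≠ k)
    (hjl : j ≠ l) (hkl : k ≠ l) :
    (Measure.pi fun _ : Fin 4 => lam).map (fun u => ((u i, u j), (u k, u l))) =
      (lam.prod lam).prod (lam.prod lam) := by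
  have hI : ProbabilityTheory.iIndepFun (fun (i : Fin 4) (ω : Fin 4 → ℝ) => ω i)
      (Measure.pi fun _ : Fin 4 => lam) :=
    ProbabilityTheory.iIndepFun_pi (X := fun _ x => x) (fun _ => aemeasurable_id)
  have hm : ∀ i : Fin 4, Measurable fun ω : Fin 4 → ℝ => ω i := fun i => measurable_pi_apply i
  have hlaw : ∀ i, (Measure.pi fun _ : Fin 4 => lam).map (fun u => u i) = lam :=
    fun i => (measurePreserving_eval (fun _ : Fin 4 => lam) i).map_eq
  have h2 : ∀ i j, i ≠ j → (Measure.pi fun _ : Fin 4 => lam).map (fun u => (u i, u j))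
      = lam.prod lam := by
    intro i j hij
    rw [(ProbabilityTheory.indepFun_iff_map_prod_eq_prod_map_map (hm i).aemeasurable
      (hm j).aemeasurable).1 (hI.indepFun hij), hlaw, hlaw]
  rw [(ProbabilityTheory.indepFun_iff_map_prod_eq_prod_map_map
    ((hm i).prodMk (hm j)).aemeasurable ((hm k).prodMk (hm l)).aemeasurable).1
    (hI.indepFun_prodMk_prodMk hm i j k l hik hil hjk hjl), h2 i j hij, h2 k l hkl]

def Cset : Set ((ℝ × ℝ) × (ℝ × ℝ)) :=
  {z | max (clamp01 z.1.1) (clamp01 z.1.2) < min (clamp01 z.2.1) (clamp01 z.2.2) ∨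
    max (clamp01 z.2.1) (clamp01 z.2.2) < min (clamp01 z.1.1) (clamp01 z.1.2)}

lemma measurable_clamp01 : Measurable clamp01 := by unfold clamp01; fun_prop

lemma measurableSet_Cset : MeasurableSet Cset := by
  have := measurable_clamp01
  have h1 : Measurable fun z : (ℝ × ℝ) × (ℝ × ℝ) => max (clamp01 z.1.1) (clamp01 z.1.2) := by
    fun_prop
  have h2 : Measurable fun z : (ℝ × ℝ) × (ℝ × ℝ) => min (clamp01 z.1.1) (clamp01 z.1.2) := by
    fun_prop
  have h3 : Measurable fun z : (ℝ × ℝ) × (ℝ × ℝ) => max (clamp01 z.2.1) (clamp01 z.2.2) := by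
    fun_prop
  have h4 : Measurable fun z : (ℝ × ℝ) × (ℝ × ℝ) => min (clamp01 z.2.1) (clamp01 z.2.2) := by
    fun_prop
  exact (measurableSet_lt h1 h4).union (measurableSet_lt h3 h2)

lemma Cset_disj (a b c d : ℝ) (h : ((a, b), (c, d)) ∈ Cset) :
    ((a, c), (b, d)) ∉ Cset ∧ ((a, d), (b, c)) ∉ Cset := by
  simp only [Cset, Set.mem_ofPred_eq, max_lt_iff, lt_min_iff] at *
  constructor <;> intro h' <;> rcases h with h | h <;> rcases h' with h' | h' <;> linarith

lemma Cset_measure : ((lam.prod lam).prod (lam.prod lam)) Cset ≤ 3⁻¹ := by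
  set P := Measure.pi fun _ : Fin 4 => lam
  have hm : ∀ i j k l : Fin 4,
      Measurable fun u : Fin 4 → ℝ => ((u i, u j), (u k, u l)) := by
    intro i j k l; fun_prop
  have e : ∀ i j k l : Fin 4, i ≠ j → i ≠ k → i ≠ l → j ≠ k → j ≠ l → k ≠ l →
      P {u | ((u i, u j), (u k, u l)) ∈ Cset} = ((lam.prod lam).prod (lam.prod lam)) Cset := by
    intro i j k l h1 h2 h3 h4 h5 h6
    rw [← pair_law i j k l h1 h2 h3 h4 h5 h6, Measure.map_apply (hm _ _ _ _) measurableSet_Cset]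
    rfl
  have hms : ∀ i j k l : Fin 4, MeasurableSet {u : Fin 4 → ℝ | ((u i, u j), (u k, u l)) ∈ Cset} :=
    fun i j k l => hm i j k l measurableSet_Cset
  have e1 := e 0 1 2 3 (by decide) (by decide) (by decide) (by decide) (by decide) (by decide)
  have e2 := e 0 2 1 3 (by decide) (by decide) (by decide) (by decide) (by decide) (by decide)
  have e3 := e 0 3 1 2 (by decide) (by decide) (by decide) (by decide) (by decide) (by decide)
  have hsum : P {u | ((u 0, u 1), (u 2, u 3)) ∈ Cset} + P {u | ((u 0, u 2), (u 1, u 3)) ∈ Cset}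
      + P {u | ((u 0, u 3), (u 1, u 2)) ∈ Cset} ≤ 1 := by
    rw [← measure_union _ (hms _ _ _ _), ← measure_union _ (hms _ _ _ _)]
    · exact prob_le_one
    · rw [Set.disjoint_left]
      rintro u (h | h) h'
      · exact (Cset_disj _ _ _ _ h).2 h'
      · refine (Cset_disj _ _ _ _ h).2 ?_
        simp only [Cset, Set.mem_ofPred_eq] at h' ⊢
        simpa only [max_comm, min_comm] using h'
    · rw [Set.disjoint_left]
      intro u h h'
      exact (Cset_disj _ _ _ _ h).1 h'
  rw [e1, e2, e3] at hsum
  rw [← one_div, ENNReal.le_div_iff_mul_le (by simp) (by simp)]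
  refine le_trans (le_of_eq ?_) hsum
  ring

def dvar {n : ℕ} (s : Bool) (a : ClauseSample n) : Fin n := if s then a.1.val.2 else a.1.val.1

def dint {n : ℕ} (s : Bool) (a : ClauseSample n) : ℝ × ℝ :=
  if s then (a.2 2, a.2 3) else (a.2 0, a.2 1)

def CRel {n m : ℕ} (ω : Fin m → ClauseSample n) (a b : Fin m × Bool) : Prop :=
  dvar a.2 (ω a.1) = dvar b.2 (ω b.1) ∧ (dint a.2 (ω a.1), dint b.2 (ω b.1)) ∈ Cset

lemma Cset_symm {J J' : ℝ × ℝ} (h : (J, J') ∈ Cset) : (J', J) ∈ Cset := Or.symm h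

lemma Cset_irrefl (J : ℝ × ℝ) : (J, J) ∉ Cset := by
  simp only [Cset, Set.mem_ofPred_eq, max_lt_iff, lt_min_iff]
  rintro (h | h) <;> linarith [h.1.1]

lemma measurable_dvar {n : ℕ} (s : Bool) : Measurable (dvar (n := n) s) := by
  cases s
  · exact measurable_fst.comp (measurable_subtype_coe.comp measurable_fst)
  · exact measurable_snd.comp (measurable_subtype_coe.comp measurable_fst)

lemma measurable_dint {n : ℕ} (s : Bool) : Measurable (dint (n := n) s) := by
  cases s
  · change Measurable fun a : ClauseSample n => (a.2 0, a.2 1)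
    fun_prop
  · change Measurable fun a : ClauseSample n => (a.2 2, a.2 3)
    fun_prop

lemma card_VarPair (n : ℕ) : Fintype.card (VarPair n) = n * (n - 1) := by
  have h := Finset.offDiag_card (Finset.univ : Finset (Fin n))
  rw [Fintype.card_subtype]
  have h2 : (Finset.univ.filter fun p : Fin n × Fin n => p.1 ≠ p.2) =
      (Finset.univ : Finset (Fin n)).offDiag := by ext; simp
  rw [h2, h]
  simp [Nat.mul_sub]

lemma uniform_prob (n : ℕ) (hn : 2 ≤ n) : IsProbabilityMeasure (uniformMeasure (VarPair n)) := by
  constructor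
  have h : Fintype.card (VarPair n) ≠ 0 := by
    rw [card_VarPair]
    have : n - 1 ≠ 0 := by omega
    positivity
  simp only [uniformMeasure, Measure.smul_apply, Measure.count_univ, smul_eq_mul, ENat.card_eq_coe_fintype_card]
  simp only [ENat.toENNReal_coe]
  rw [ENNReal.inv_mul_cancel]
  · exact_mod_cast h
  · exact ENNReal.natCast_ne_top _

lemma clause_prob (n : ℕ) (hn : 2 ≤ n) : IsProbabilityMeasure (clauseSampleMeasure n) := by
  have := uniform_prob n hn
  unfold clauseSampleMeasure
  infer_instance

lemma pi4_int (f g : ℝ × ℝ → ℝ≥0∞) (hf : Measurable f) (hg : Measurable g) (i j k l : Fin 4)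
    (hij : i ≠ j) (hik : i ≠ k) (hil : i ≠ l) (hjk : j ≠ k) (hjl : j ≠ l) (hkl : k ≠ l) :
    ∫⁻ u, f (u i, u j) * g (u k, u l) ∂(Measure.pi fun _ : Fin 4 => lam) =
      (∫⁻ x, f x ∂(lam.prod lam)) * ∫⁻ x, g x ∂(lam.prod lam) := by
  rw [← lintegral_prod_mul hf.aemeasurable hg.aemeasurable,
    ← pair_law i j k l hij hik hil hjk hjl hkl, lintegral_map]
  · fun_prop
  · fun_prop

lemma step_int (n : ℕ) (hn : 2 ≤ n) (s : Bool) (x y : Fin n) (f g : ℝ × ℝ → ℝ≥0∞)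
    (hf : Measurable f) (hg : Measurable g) :
    ∫⁻ a, (if dvar (!s) a = x ∧ dvar s a = y then 1 else 0) *
      (f (dint (!s) a) * g (dint s a)) ∂(clauseSampleMeasure n) ≤
      ((n * (n - 1) : ℕ) : ℝ≥0∞)⁻¹ * (∫⁻ x, f x ∂(lam.prod lam)) *
        ∫⁻ x, g x ∂(lam.prod lam) := by
  have := uniform_prob n hn
  let S : Set (VarPair n) := {v | (if (!s) = true then v.val.2 else v.val.1) = x ∧
    (if s = true then v.val.2 else v.val.1) = y}
  have hS : MeasurableSet S := S.toFinite.measurableSet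
  let h : (Fin 4 → ℝ) → ℝ≥0∞ := fun u =>
    f (if (!s) = true then (u 2, u 3) else (u 0, u 1)) * g (if s = true then (u 2, u 3) else (u 0, u 1))
  have hh : Measurable h := by
    cases s <;> simp only [h] <;> simp <;> fun_prop
  have e1 : ∫⁻ a, (if dvar (!s) a = x ∧ dvar s a = y then 1 else 0) *
      (f (dint (!s) a) * g (dint s a)) ∂(clauseSampleMeasure n) =
      ∫⁻ a : ClauseSample n, S.indicator 1 a.1 * h a.2 ∂(clauseSampleMeasure n) := by
    refine lintegral_congr fun a => ?_
    simp only [Set.indicator_apply, S, h, dvar, dint, Set.mem_ofPred_eq, Pi.one_apply]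
    congr
  rw [e1]
  unfold clauseSampleMeasure
  rw [lintegral_prod_mul (measurable_one.indicator hS).aemeasurable hh.aemeasurable,
    lintegral_indicator_one hS, mul_assoc]
  refine mul_le_mul' ?_ (le_of_eq ?_)
  · have hsub : S.Subsingleton := by
      rintro ⟨⟨a, b⟩, h1⟩ ha ⟨⟨c, d⟩, h2⟩ hb
      cases s <;> simp [S] at ha hb ⊢ <;> simp_all
    rw [← card_VarPair]
    simp only [uniformMeasure, Measure.smul_apply, smul_eq_mul]
    refine (mul_le_mul' le_rfl ?_).trans (mul_one _).le
    rcases hsub.eq_empty_or_singleton with h | ⟨v, h⟩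
    · simp [h]
    · simp [h]
  · cases s
    · simp only [h]
      simp
      rw [← mul_comm (∫⁻ x, g x ∂(lam.prod lam)), ← pi4_int g f hg hf 0 1 2 3 (by decide) (by decide) (by decide)
        (by decide) (by decide) (by decide)]
      simp_rw [mul_comm]
    · simp only [h]
      simp
      exact pi4_int f g hf hg 0 1 2 3 (by decide) (by decide) (by decide)
        (by decide) (by decide) (by decide)

lemma restrict_mp {A : Type*} [MeasurableSpace A] (μ : Measure A) [IsProbabilityMeasure μ]
    {k m : ℕ} (e : Fin k → Fin m) (he : Function.Injective e) :
    MeasurePreserving (fun (ω : Fin m → A) l => ω (e l)) (Measure.pi fun _ => μ)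
      (Measure.pi fun _ => μ) := by
  refine ⟨by fun_prop, ?_⟩
  have hI : ProbabilityTheory.iIndepFun (fun (i : Fin m) (ω : Fin m → A) => ω i)
      (Measure.pi fun _ : Fin m => μ) :=
    ProbabilityTheory.iIndepFun_pi (X := fun _ x => x) (fun _ => aemeasurable_id)
  have h2 := hI.precomp he
  rw [ProbabilityTheory.iIndepFun_iff_map_fun_eq_pi_map
    (fun i => (measurable_pi_apply _).aemeasurable)] at h2
  refine h2.trans ?_
  congr 1
  ext1 i
  exact (measurePreserving_eval (fun _ : Fin m => μ) (e i)).map_eq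

def Ev {n m : ℕ} (K : ℕ) (e : Fin (K+1) → Fin m) (σ : Fin (K+1) → Bool)
    (xin xout : Fin (K+1) → Fin n) : Set (Fin m → ClauseSample n) :=
  {ω | Function.Injective e ∧ (∀ l, dvar (!σ l) (ω (e l)) = xin l ∧ dvar (σ l) (ω (e l)) = xout l) ∧
    ∀ l : Fin K, (dint (σ l.castSucc) (ω (e l.castSucc)), dint (!σ l.succ) (ω (e l.succ))) ∈ Cset}

lemma Ev_measure {n m : ℕ} (hn : 2 ≤ n) (K : ℕ) (e : Fin (K+1) → Fin m) (σ : Fin (K+1) → Bool)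
    (xin xout : Fin (K+1) → Fin n) :
    formulaSampleMeasure n m (Ev K e σ xin xout) ≤
      (((n * (n - 1) : ℕ) : ℝ≥0∞)⁻¹) ^ (K+1) * (3⁻¹) ^ K := by
  by_cases he : Function.Injective e
  swap
  · simp [Ev, he]
  have := clause_prob n hn
  let C : ℝ × ℝ → ℝ × ℝ → ℝ≥0∞ := fun x y => Cset.indicator 1 (x, y)
  have hCm : Measurable (Function.uncurry C) := measurable_one.indicator measurableSet_Cset
  have hC : ∫⁻ y, ∫⁻ x, C x y ∂(lam.prod lam) ∂(lam.prod lam) ≤ 3⁻¹ := by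
    refine le_trans (le_of_eq ?_) Cset_measure
    rw [← lintegral_indicator_one measurableSet_Cset]
    exact (lintegral_prod_symm' _ hCm).symm
  have hV : ∀ l, Measurable fun a : ClauseSample n =>
      (if dvar (!σ l) a = xin l ∧ dvar (σ l) a = xout l then 1 else 0 : ℝ≥0∞) := by
    intro l
    refine Measurable.ite ?_ measurable_const measurable_const
    exact (measurable_dvar _ (measurableSet_singleton _)).inter
      (measurable_dvar _ (measurableSet_singleton _))
  have key := chain_int (clauseSampleMeasure n) (lam.prod lam) C hCm
    (((n * (n - 1) : ℕ) : ℝ≥0∞)⁻¹) 3⁻¹ hC K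
    (fun l a => if dvar (!σ l) a = xin l ∧ dvar (σ l) a = xout l then 1 else 0)
    (fun l => dint (!σ l)) (fun l => dint (σ l)) hV
    (fun l => measurable_dint _) (fun l => measurable_dint _)
    (fun l f g hf hg => step_int n hn (σ l) (xin l) (xout l) f g hf hg) (fun _ => 1)
    measurable_const
  simp only [lintegral_const, measure_univ, mul_one] at key
  refine le_trans ?_ key
  rw [← (restrict_mp (clauseSampleMeasure n) e he).lintegral_comp]
  · rw [formulaSampleMeasure]
    refine le_trans (measure_mono ?_) ((meas_ge_le_lintegral_div (ε := 1) ?_ one_ne_zero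
      ENNReal.one_ne_top).trans (by rw [div_one]))
    · rintro ω ⟨_, h1, h2⟩
      simp only [Set.mem_ofPred_eq]
      rw [Finset.prod_eq_one, Finset.prod_eq_one]
      · simp
      · intro l _
        simp only [C]
        rw [Set.indicator_of_mem (h2 l)]
        rfl
      · intro l _
        rw [if_pos (h1 l)]
    · refine Measurable.aemeasurable ?_
      refine measurable_const.mul (Measurable.mul ?_ ?_)
      · exact Finset.measurable_prod _ fun l _ => (hV l).comp (measurable_pi_apply _)
      · refine Finset.measurable_prod _ fun l _ => ?_
        exact hCm.comp (((measurable_dint (σ l.castSucc)).comp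
          (measurable_pi_apply (e l.castSucc))).prodMk
          ((measurable_dint (!σ l.succ)).comp (measurable_pi_apply (e l.succ))))
  · refine measurable_const.mul (Measurable.mul ?_ ?_)
    · exact Finset.measurable_prod _ fun l _ => (hV l).comp (measurable_pi_apply _)
    · refine Finset.measurable_prod _ fun l _ => ?_
      exact hCm.comp (((measurable_dint (σ l.castSucc)).comp
        (measurable_pi_apply l.castSucc)).prodMk
        ((measurable_dint (!σ l.succ)).comp (measurable_pi_apply l.succ)))

lemma sat_of_choice {n m : ℕ} (ω : Fin m → ClauseSample n) (s : Fin m → Bool)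
    (hs : ∀ i j, ¬ CRel ω (i, s i) (j, s j)) :
    ∃ v : Fin n → ℝ, (randomFormula n m ω).Satisfies v := by
  classical
  let J : Fin m → ℝ × ℝ := fun i => dint (s i) (ω i)
  let x : Fin m → Fin n := fun i => dvar (s i) (ω i)
  let lo : Fin m → ℝ := fun i => min (clamp01 (J i).1) (clamp01 (J i).2)
  let hi : Fin m → ℝ := fun i => max (clamp01 (J i).1) (clamp01 (J i).2)
  have hlohi : ∀ i j, x i = x j → lo i ≤ hi j := by
    intro i j hij
    by_contra hlt
    push Not at hlt
    exact hs i j ⟨hij, Or.inr hlt⟩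
  have hc : ∀ t, clamp01 t ∈ Set.Icc (0 : ℝ) 1 := fun t =>
    ⟨le_max_left _ _, max_le zero_le_one (min_le_right _ _)⟩
  have hv : ∀ z : Fin n, ∃ t ∈ Set.Icc (0 : ℝ) 1, ∀ i, x i = z → lo i ≤ t ∧ t ≤ hi i := by
    intro z
    by_cases hne : (Finset.univ.filter fun i => x i = z).Nonempty
    · obtain ⟨i0, hi0, hmax⟩ := Finset.exists_max_image _ lo hne
      simp only [Finset.mem_filter, Finset.mem_univ, true_and] at hi0 hmax
      refine ⟨lo i0, ⟨le_min (hc _).1 (hc _).1, (min_le_left _ _).trans (hc _).2⟩, ?_⟩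
      intro i hi
      exact ⟨hmax i hi, hlohi _ _ (hi0.trans hi.symm)⟩
    · refine ⟨0, by simp, ?_⟩
      intro i hi
      exact (hne ⟨i, by simpa using hi⟩).elim
  choose v hv1 hv2 using hv
  refine ⟨v, hv1, ?_⟩
  intro c hcm
  simp only [randomFormula, List.mem_ofFn] at hcm
  obtain ⟨i, rfl⟩ := hcm
  have h := hv2 (x i) i rfl
  simp only [x, lo, hi, J] at h
  cases hsi : s i
  · left
    simpa [hsi, dvar, dint, ISatLiteral.interval, mkLiteral] using h
  · right
    simpa [hsi, dvar, dint, ISatLiteral.interval, mkLiteral] using h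

lemma bicycle_mem {n m : ℕ} (ω : Fin m → ClauseSample n) (L : List (Fin m × Bool))
    (hL : Bicycle (CRel ω) L) :
    ∃ K ∈ Finset.range m, ∃ q : (Fin (K+1) → Fin m) × (Fin (K+1) → Bool) × (Fin K → Fin n) ×
      Fin K × Fin K, ω ∈ Ev K q.1 q.2.1 (Fin.cons (q.2.2.1 q.2.2.2.1) q.2.2.1)
        (Fin.snoc (α := fun _ => Fin n) q.2.2.1 (q.2.2.1 q.2.2.2.2)) := by
  obtain ⟨⟨hch, hnd, c, hcL, b, hb, hbc⟩, d, hd, b0, hb0, hdb⟩ := hL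
  obtain ⟨K, hK⟩ : ∃ K, L.length = K + 1 :=
    Nat.exists_eq_succ_of_ne_zero (List.length_pos_of_mem hcL).ne'
  have hirr : ∀ a, ¬ CRel ω a a := fun a h => Cset_irrefl _ h.2
  let f : Fin (K+1) → Fin m × Bool := fun l => L[l.val]'(by omega)
  let dv : Fin m × Bool → Fin n := fun a => dvar a.2 (ω a.1)
  have hinj : Function.Injective fun l => (f l).1 := by
    intro l l' h
    have h1 := (List.nodup_iff_injective_get.1 hnd)
      (a₁ := ⟨l.val, by simp; omega⟩) (a₂ := ⟨l'.val, by simp; omega⟩)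
    simp only [List.get_eq_getElem, List.getElem_map, Fin.mk.injEq] at h1
    exact Fin.ext (h1 h)
  have hKm : K < m := by
    have := Fintype.card_le_of_injective _ hinj
    simp at this
    omega
  have harr : ∀ l : Fin K, CRel ω (f l.castSucc) (dbar (f l.succ)) := by
    intro l
    exact List.isChain_iff_getElem.1 hch l.val (by omega)
  have hlast : b = f (Fin.last K) := by
    rw [List.getLast?_eq_getElem?] at hb
    simp [hK] at hb
    exact hb.symm
  have hhead : b0 = f 0 := by
    rw [List.head?_eq_getElem?] at hb0
    simp [hK] at hb0
    exact hb0.symm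
  have hmem : ∀ a ∈ L, ∃ l, a = f l := by
    intro a ha
    obtain ⟨i, hi, rfl⟩ := List.getElem_of_mem ha
    exact ⟨⟨i, by omega⟩, rfl⟩
  let y : Fin K → Fin n := fun l => dv (f l.castSucc)
  obtain ⟨s, hs⟩ : ∃ s : Fin K, dv (f (Fin.last K)) = y s := by
    obtain ⟨s0, rfl⟩ := hmem c hcL
    subst hlast
    induction s0 using Fin.lastCases with
    | last => exact (hirr _ hbc).elim
    | cast s => exact ⟨s, hbc.1⟩
  obtain ⟨j, hj⟩ : ∃ j : Fin K, dv (dbar (f 0)) = y j := by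
    subst hhead
    obtain ⟨d', hd', hdd⟩ := List.mem_map.1 hd
    obtain ⟨j0, rfl⟩ := hmem d' hd'
    rcases eq_or_dbar hdd.symm with rfl | rfl
    · induction j0 using Fin.lastCases with
      | last => exact ⟨s, hdb.1.symm.trans hs⟩
      | cast j => exact ⟨j, hdb.1.symm⟩
    · induction j0 using Fin.cases with
      | zero => exact (hirr _ hdb).elim
      | succ j => exact ⟨j, hdb.1.symm.trans (harr j).1.symm⟩
  refine ⟨K, Finset.mem_range.2 hKm, ⟨fun l => (f l).1, fun l => (f l).2, y, j, s⟩, hinj, ?_, ?_⟩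
  · intro l
    constructor
    · induction l using Fin.cases with
      | zero => exact hj
      | succ l => exact (harr l).1.symm
    · induction l using Fin.lastCases with
      | last => simpa using hs
      | cast l => simp [y, dv]
  · intro l
    exact (harr l).2

lemma unsat_bound {n m : ℕ} (hn : 2 ≤ n) :
    formulaSampleMeasure n m {ω | ¬ ∃ v : Fin n → ℝ, (randomFormula n m ω).Satisfies v} ≤
      ∑ K ∈ Finset.range m, ((m ^ (K+1) * (2 ^ (K+1) * (n ^ K * (K * K))) : ℕ) : ℝ≥0∞) *
        ((((n * (n - 1) : ℕ) : ℝ≥0∞)⁻¹) ^ (K+1) * (3⁻¹) ^ K) := by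
  have hsub : {ω | ¬ ∃ v : Fin n → ℝ, (randomFormula n m ω).Satisfies v} ⊆
      ⋃ K ∈ Finset.range m, ⋃ q : (Fin (K+1) → Fin m) × (Fin (K+1) → Bool) × (Fin K → Fin n) ×
      Fin K × Fin K, Ev K q.1 q.2.1 (Fin.cons (q.2.2.1 q.2.2.2.1) q.2.2.1)
        (Fin.snoc (α := fun _ => Fin n) q.2.2.1 (q.2.2.1 q.2.2.2.2)) := by
    intro ω hω
    have h1 : ¬ ∃ s : Fin m → Bool, ∀ i j, ¬ CRel ω (i, s i) (j, s j) :=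
      fun ⟨s, hs⟩ => hω (sat_of_choice ω s hs)
    obtain ⟨L, hL⟩ := exists_bicycle (fun a b h => ⟨h.1.symm, Cset_symm h.2⟩) h1
    obtain ⟨K, hK, q, hq⟩ := bicycle_mem ω L hL
    simp only [Set.mem_iUnion]
    exact ⟨K, hK, q, hq⟩
  refine (measure_mono hsub).trans ((measure_biUnion_finset_le _ _).trans ?_)
  refine Finset.sum_le_sum fun K _ => ?_
  refine (measure_iUnion_fintype_le _ _).trans ?_
  refine (Finset.sum_le_sum fun q _ => Ev_measure hn K _ _ _ _).trans (le_of_eq ?_)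
  rw [Finset.sum_const, nsmul_eq_mul]
  congr 2
  simp

lemma term_bound {n m K : ℕ} (hn : 2 ≤ n) (ρ : ℝ) (h : 2 * (m : ℝ) ≤ 3 * ρ * (n - 1)) :
    ((m ^ (K+1) * (2 ^ (K+1) * (n ^ K * (K * K))) : ℕ) : ℝ≥0∞) *
        ((((n * (n - 1) : ℕ) : ℝ≥0∞)⁻¹) ^ (K+1) * (3⁻¹) ^ K) ≤
      ENNReal.ofReal (3 / n * ((K : ℝ) ^ 2 * ρ ^ (K + 1))) := by
  have hn' : (2 : ℝ) ≤ n := by exact_mod_cast hn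
  have hn0 : (0 : ℝ) < n := by linarith
  have hn1 : (0 : ℝ) < n - 1 := by linarith
  have hnn : n * (n - 1) ≠ 0 := by
    have : n - 1 ≠ 0 := by omega
    positivity
  have hfin : ((m ^ (K+1) * (2 ^ (K+1) * (n ^ K * (K * K))) : ℕ) : ℝ≥0∞) *
        ((((n * (n - 1) : ℕ) : ℝ≥0∞)⁻¹) ^ (K+1) * (3⁻¹) ^ K) ≠ ⊤ := by
    refine ENNReal.mul_ne_top (ENNReal.natCast_ne_top _) (ENNReal.mul_ne_top ?_ ?_)
    · refine ENNReal.pow_ne_top (ENNReal.inv_ne_top.2 ?_)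
      exact_mod_cast hnn
    · exact ENNReal.pow_ne_top (ENNReal.inv_ne_top.2 (by simp))
  rw [← ENNReal.ofReal_toReal hfin]
  refine ENNReal.ofReal_le_ofReal ?_
  rw [ENNReal.toReal_mul, ENNReal.toReal_mul, ENNReal.toReal_pow, ENNReal.toReal_pow,
    ENNReal.toReal_inv, ENNReal.toReal_inv, ENNReal.toReal_natCast, ENNReal.toReal_natCast]
  push_cast [Nat.cast_sub (show 1 ≤ n by omega)]
  have e : (m : ℝ) ^ (K+1) * (2 ^ (K+1) * (n ^ K * (K * K))) *
      (((n : ℝ) * (n - 1))⁻¹ ^ (K+1) * (ENNReal.toReal 3)⁻¹ ^ K) =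
      3 / n * ((K : ℝ) ^ 2 * (2 * m / (3 * (n - 1))) ^ (K+1)) := by
    have h3 : ENNReal.toReal 3 = 3 := by simp
    rw [h3, inv_pow, inv_pow, div_pow, mul_pow, mul_pow, mul_pow]
    field_simp
    ring
  rw [e]
  have : 2 * (m : ℝ) / (3 * (n - 1)) ≤ ρ := by
    rw [div_le_iff₀ (by positivity)]
    linarith
  gcongr

theorem stmt_aux (c' : ℝ) (hc' : c' < 3 / 2) (m : ℕ → ℕ)
    (hm : ∀ n : ℕ, 2 ≤ n → (m n : ℝ) ≤ c' * n) :
    Filter.Tendsto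
      (fun n : ℕ =>
        formulaSampleMeasure n (m n)
          {ω | ¬ ∃ v : Fin n → ℝ, (randomFormula n (m n) ω).Satisfies v})
      Filter.atTop (nhds 0) := by
  obtain ⟨ρ, hρ1, hρ2⟩ : ∃ ρ : ℝ, max (2 * c' / 3) 0 < ρ ∧ ρ < 1 :=
    exists_between (max_lt (by linarith) one_pos)
  obtain ⟨hρc, hρ0⟩ := max_lt_iff.1 hρ1
  have hS0 : Summable fun K : ℕ => (K : ℝ) ^ 2 * ρ ^ K :=
    summable_pow_mul_geometric_of_norm_lt_one 2 (by rwa [Real.norm_of_nonneg hρ0.le])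
  have hS : Summable fun K : ℕ => (K : ℝ) ^ 2 * ρ ^ (K + 1) := by
    refine (hS0.mul_right ρ).congr fun K => ?_
    ring
  set S := ∑' K : ℕ, (K : ℝ) ^ 2 * ρ ^ (K + 1)
  have hlim : Filter.Tendsto (fun n : ℕ => ENNReal.ofReal (3 / (n : ℝ) * S)) Filter.atTop
      (nhds 0) := by
    rw [← ENNReal.ofReal_zero]
    refine ENNReal.tendsto_ofReal ?_
    have := (tendsto_const_div_atTop_nhds_zero_nat (3 : ℝ)).mul_const S
    rwa [zero_mul] at this
  refine tendsto_of_tendsto_of_tendsto_of_le_of_le' tendsto_const_nhds hlim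
    (Filter.Eventually.of_forall fun _ => zero_le) ?_
  obtain ⟨N, hN⟩ := exists_nat_ge (3 * ρ / (3 * ρ - 2 * c'))
  filter_upwards [Filter.eventually_ge_atTop 2, Filter.eventually_ge_atTop N] with n hn hnN
  have hpos : 0 < 3 * ρ - 2 * c' := by linarith
  have h1 : 3 * ρ ≤ n * (3 * ρ - 2 * c') := by
    rw [← div_le_iff₀ hpos]
    exact hN.trans (by exact_mod_cast hnN)
  have h2 : 2 * (m n : ℝ) ≤ 3 * ρ * (n - 1) := by
    have := hm n hn
    nlinarith
  refine (unsat_bound hn).trans ((Finset.sum_le_sum fun K _ => term_bound hn ρ h2).trans ?_)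
  rw [← ENNReal.ofReal_sum_of_nonneg (fun K _ => by positivity), ← Finset.mul_sum]
  refine ENNReal.ofReal_le_ofReal ?_
  refine mul_le_mul_of_nonneg_left ?_ (by positivity)
  exact hS.sum_le_tsum _ (fun K _ => by positivity)

/-- If `c' < 3/2` and `m(n) ≤ c'·n`, then whp (as `n → ∞`) a random 2-iSAT formula
on `n` variables with `m(n)` clauses is satisfiable. -/
theorem stmt_1 (c' : ℝ) (hc' : c' < 3 / 2) (m : ℕ → ℕ)
    (hm : ∀ n : ℕ, 2 ≤ n → (m n : ℝ) ≤ c' * n) :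
    Filter.Tendsto
      (fun n : ℕ =>
        formulaSampleMeasure n (m n)
          {ω | ∃ v : Fin n → ℝ, (randomFormula n (m n) ω).Satisfies v})
      Filter.atTop (nhds 1) := by
  have h0 := stmt_aux c' hc' m hm
  have h1 := ENNReal.Tendsto.sub (tendsto_const_nhds (x := (1 : ℝ≥0∞)) (f := Filter.atTop)) h0
    (Or.inl ENNReal.one_ne_top)
  rw [tsub_zero] at h1
  refine tendsto_of_tendsto_of_tendsto_of_le_of_le' h1 tendsto_const_nhds ?_ ?_
  · filter_upwards [Filter.eventually_ge_atTop 2] with n hn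
    have := clause_prob n hn
    have hp : IsProbabilityMeasure (formulaSampleMeasure n (m n)) := by
      unfold formulaSampleMeasure; infer_instance
    rw [tsub_le_iff_right, ← hp.measure_univ]
    refine (measure_mono ?_).trans (measure_union_le _ _)
    intro ω _
    exact em _
  · filter_upwards [Filter.eventually_ge_atTop 2] with n hn
    have := clause_prob n hn
    have hp : IsProbabilityMeasure (formulaSampleMeasure n (m n)) := by
      unfold formulaSampleMeasure; infer_instance
    exact prob_le_one
end

section
/- For every c ∈ (0, 3] there exists a function y : ℝ → ℝ such that y(1) = 0, y(x) < 12x for all x ∈ (0,1], and for every x ∈ (0,1] the function y is differentiable at x with derivative y'(x) = (−18c·x⁴ + 2·y(x)·(12x − y(x))) / (x·(12x − y(x))); moreover, any two functions with these properties agree at every point of (0,1]. -/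
open Set

noncomputable def EE (c u : ℝ) : ℝ := Real.exp (-u ^ 2 / (36 * c))
noncomputable def JJ (c u : ℝ) : ℝ := 1 - 2 / (3 * c) * ∫ s in (0 : ℝ)..u, EE c s
noncomputable def XX (c u : ℝ) : ℝ := JJ c u / EE c u

lemma EE_pos (c u : ℝ) : 0 < EE c u := Real.exp_pos _

lemma EE_cont (c : ℝ) : Continuous (EE c) := by
  unfold EE; fun_prop

lemma EE_deriv (c : ℝ) (hc : 0 < c) (u : ℝ) :
    HasDerivAt (EE c) (-(u / (18 * c)) * EE c u) u := by
  have h : HasDerivAt (fun u : ℝ => -u ^ 2 / (36 * c)) (-(u / (18 * c))) u := by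
    have h := ((hasDerivAt_pow 2 u).neg).div_const (36 * c)
    refine h.congr_deriv ?_
    field_simp
    norm_num
    try ring
  have := h.exp
  refine this.congr_deriv ?_
  unfold EE
  ring

lemma II_deriv (c : ℝ) (u : ℝ) :
    HasDerivAt (fun u => ∫ s in (0 : ℝ)..u, EE c s) (EE c u) u :=
  intervalIntegral.integral_hasDerivAt_right ((EE_cont c).intervalIntegrable _ _)
    ((EE_cont c).stronglyMeasurableAtFilter _ _) (EE_cont c).continuousAt

lemma JJ_deriv (c : ℝ) (u : ℝ) :
    HasDerivAt (JJ c) (-(2 / (3 * c) * EE c u)) u :=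
  ((II_deriv c u).const_mul (2 / (3 * c))).const_sub 1

lemma JJ_zero (c : ℝ) : JJ c 0 = 1 := by simp [JJ]

lemma JJ_anti (c : ℝ) (hc : 0 < c) : StrictAnti (JJ c) := by
  apply strictAnti_of_deriv_neg
  intro x
  rw [(JJ_deriv c x).deriv]
  have := EE_pos c x
  have : 0 < 2 / (3 * c) * EE c x := by positivity
  linarith

lemma JJ_root (c : ℝ) (hc : c ∈ Ioc (0 : ℝ) 3) : ∃ b, 0 < b ∧ JJ c b = 0 := by
  obtain ⟨h0, h3⟩ := hc
  have hd : ∀ u, HasDerivAt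
      (fun u => (∫ s in (0 : ℝ)..u, EE c s) - u + u ^ 3 / (108 * c))
      (EE c u - 1 + u ^ 2 / (36 * c)) u := by
    intro u
    have := ((II_deriv c u).sub (hasDerivAt_id u)).add ((hasDerivAt_pow 3 u).div_const (108 * c))
    refine this.congr_deriv ?_
    field_simp
    norm_num
    try ring
  have hm : Monotone (fun u => (∫ s in (0 : ℝ)..u, EE c s) - u + u ^ 3 / (108 * c)) := by
    apply monotone_of_deriv_nonneg (fun u => (hd u).differentiableAt)
    intro u
    rw [(hd u).deriv]
    have := Real.add_one_le_exp (-u ^ 2 / (36 * c))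
    unfold EE
    rw [neg_div] at *
    linarith
  have h := hm (show (0 : ℝ) ≤ 3 * c by positivity)
  simp only [intervalIntegral.integral_same] at h
  have e : (3 * c) ^ 3 / (108 * c) = c ^ 2 / 4 := by field_simp; norm_num
  rw [e] at h
  have ez : (0 : ℝ) ^ 3 / (108 * c) = 0 := by norm_num
  rw [ez] at h
  have h2 : JJ c (3 * c) ≤ 0 := by
    unfold JJ
    have : 3 * c / 2 ≤ ∫ s in (0 : ℝ)..(3 * c), EE c s := by nlinarith
    have h5 : 2 / (3 * c) * (3 * c / 2) ≤ 2 / (3 * c) * ∫ s in (0 : ℝ)..(3 * c), EE c s := by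
      gcongr
    have h6 : 2 / (3 * c) * (3 * c / 2) = 1 := by field_simp
    linarith
  have hcont : Continuous (JJ c) :=
    continuous_iff_continuousAt.2 fun u => (JJ_deriv c u).continuousAt
  obtain ⟨b, hb, hb'⟩ := intermediate_value_Icc' (show (0 : ℝ) ≤ 3 * c by positivity)
    hcont.continuousOn (show (0 : ℝ) ∈ Icc (JJ c (3 * c)) (JJ c 0) by
      rw [JJ_zero]; exact ⟨h2, zero_le_one⟩)
  refine ⟨b, lt_of_le_of_ne hb.1 ?_, hb'⟩
  rintro rfl
  rw [JJ_zero] at hb'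
  exact one_ne_zero hb'

lemma q_pos (c : ℝ) (hc : c ∈ Ioc (0 : ℝ) 3) (u : ℝ) : 0 < 12 * EE c u - u * JJ c u := by
  obtain ⟨b, hb, hJb⟩ := JJ_root c hc
  have hE := EE_pos c u
  have ha := JJ_anti c hc.1
  have h0 := hc.1
  rcases le_total u 0 with hu | hu
  · have : JJ c 0 ≤ JJ c u := ha.antitone hu
    rw [JJ_zero] at this
    nlinarith
  rcases le_total b u with hbu | hbu
  · have : JJ c u ≤ JJ c b := ha.antitone hbu
    rw [hJb] at this
    nlinarith
  have hd : ∀ v, HasDerivAt (fun u => 12 * EE c u - u * JJ c u) (-JJ c v) v := by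
    intro v
    have := ((EE_deriv c hc.1 v).const_mul 12).sub ((hasDerivAt_id v).mul (JJ_deriv c v))
    refine this.congr_deriv ?_
    simp only [id]
    field_simp
    ring
  have hm : AntitoneOn (fun u => 12 * EE c u - u * JJ c u) (Icc 0 b) := by
    apply antitoneOn_of_deriv_nonpos (convex_Icc 0 b)
    · exact fun v _ => (hd v).continuousAt.continuousWithinAt
    · exact fun v _ => (hd v).differentiableAt.differentiableWithinAt
    · intro v hv
      rw [interior_Icc] at hv
      rw [(hd v).deriv]
      have := ha hv.2
      linarith
  have h := hm ⟨hu, hbu⟩ ⟨hb.le, le_rfl⟩ hbu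
  simp only [hJb] at h
  have := EE_pos c b
  linarith

lemma XX_deriv (c : ℝ) (hc : 0 < c) (u : ℝ) :
    HasDerivAt (XX c) (-((12 - u * XX c u) / (18 * c))) u := by
  have hE := (EE_pos c u).ne'
  have := (JJ_deriv c u).div (EE_deriv c hc u) hE
  refine this.congr_deriv ?_
  unfold XX
  field_simp
  ring

lemma p_pos (c : ℝ) (hc : c ∈ Ioc (0 : ℝ) 3) (u : ℝ) : 0 < 12 - u * XX c u := by
  have hE := EE_pos c u
  have := div_pos (q_pos c hc u) hE
  have e : (12 * EE c u - u * JJ c u) / EE c u = 12 - u * XX c u := by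
    unfold XX; field_simp
  rwa [e] at this

lemma XX_anti (c : ℝ) (hc : c ∈ Ioc (0 : ℝ) 3) : StrictAnti (XX c) := by
  apply strictAnti_of_deriv_neg
  intro u
  rw [(XX_deriv c hc.1 u).deriv]
  have := p_pos c hc u
  have h0 := hc.1
  have : 0 < (12 - u * XX c u) / (18 * c) := by positivity
  linarith

lemma XX_cont (c : ℝ) (hc : 0 < c) : Continuous (XX c) :=
  continuous_iff_continuousAt.2 fun u => (XX_deriv c hc u).continuousAt

lemma XX_zero (c : ℝ) : XX c 0 = 1 := by simp [XX, JJ_zero, EE]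

lemma XX_strict (c : ℝ) (hc : 0 < c) (u : ℝ) :
    HasStrictDerivAt (XX c) (-((12 - u * XX c u) / (18 * c))) u := by
  apply hasStrictDerivAt_of_hasDerivAt_of_continuousAt
    (f' := fun u => -((12 - u * XX c u) / (18 * c)))
  · exact Filter.Eventually.of_forall (XX_deriv c hc)
  · have := XX_cont c hc
    exact Continuous.continuousAt (by fun_prop)

lemma sol_eq (c : ℝ) (hc : 0 < c) (y : ℝ → ℝ) (h1 : y 1 = 0)
    (hlt : ∀ x ∈ Set.Ioc (0 : ℝ) 1, y x < 12 * x)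
    (hd : ∀ x ∈ Set.Ioc (0 : ℝ) 1,
        HasDerivAt y
          ((-18 * c * x ^ 4 + 2 * y x * (12 * x - y x)) / (x * (12 * x - y x))) x)
    (x : ℝ) (hx : x ∈ Set.Ioc (0 : ℝ) 1) : XX c (y x / x ^ 2) = x := by
  have key : ∀ t ∈ Set.Ioc (0 : ℝ) 1, HasDerivAt
      (fun t => t * EE c (y t / t ^ 2) - JJ c (y t / t ^ 2)) 0 t := by
    intro t ht
    have ht0 : t ≠ 0 := ht.1.ne'
    have hp : 12 * t - y t ≠ 0 := (sub_pos.2 (hlt t ht)).ne'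
    have hu : HasDerivAt (fun t => y t / t ^ 2) (-(18 * c * t / (12 * t - y t))) t := by
      have := (hd t ht).div (hasDerivAt_pow 2 t) (pow_ne_zero 2 ht0)
      refine this.congr_deriv ?_
      obtain ⟨p, hpp⟩ : ∃ p, y t = 12 * t - p := ⟨12 * t - y t, by ring⟩
      rw [hpp, sub_sub_cancel] at hp ⊢
      field_simp
      norm_num
      try ring
    have hEu := (EE_deriv c hc (y t / t ^ 2)).comp t hu
    have hJu := (JJ_deriv c (y t / t ^ 2)).comp t hu
    have := ((hasDerivAt_id t).mul hEu).sub hJu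
    refine this.congr_deriv ?_
    simp only [id, Function.comp]
    generalize EE c (y t / t ^ 2) = E
    obtain ⟨p, hpp⟩ : ∃ p, y t = 12 * t - p := ⟨12 * t - y t, by ring⟩
    rw [hpp, sub_sub_cancel] at hp ⊢
    field_simp
    ring
  have hcst := constant_of_has_deriv_right_zero (a := x) (b := 1)
    (f := fun t => t * EE c (y t / t ^ 2) - JJ c (y t / t ^ 2))
    (fun t ht => (key t ⟨hx.1.trans_le ht.1, ht.2⟩).continuousAt.continuousWithinAt)
    (fun t ht => (key t ⟨hx.1.trans_le ht.1, ht.2.le⟩).hasDerivWithinAt)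
    1 ⟨hx.2, le_rfl⟩
  simp only [h1, zero_div, JJ_zero] at hcst
  have e : EE c 0 = 1 := by simp [EE]
  rw [e] at hcst
  have hE := EE_pos c (y x / x ^ 2)
  unfold XX
  rw [div_eq_iff hE.ne']
  linarith


/-- For every `c ∈ (0,3]` the initial value problem
`dy/dx = (−18cx⁴ + 2y(12x − y))/(x(12x − y))`, `y(1) = 0`, has a solution on `(0,1]`
staying below the line `y = 12x`, and any two such solutions agree on `(0,1]`. -/
theorem stmt_2 (c : ℝ) (hc : c ∈ Set.Ioc (0 : ℝ) 3) :
    (∃ y : ℝ → ℝ, y 1 = 0 ∧ (∀ x ∈ Set.Ioc (0 : ℝ) 1, y x < 12 * x) ∧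
      (∀ x ∈ Set.Ioc (0 : ℝ) 1,
        HasDerivAt y
          ((-18 * c * x ^ 4 + 2 * y x * (12 * x - y x)) / (x * (12 * x - y x))) x)) ∧
    (∀ y₁ y₂ : ℝ → ℝ,
      (y₁ 1 = 0 ∧ (∀ x ∈ Set.Ioc (0 : ℝ) 1, y₁ x < 12 * x) ∧
        (∀ x ∈ Set.Ioc (0 : ℝ) 1,
          HasDerivAt y₁
            ((-18 * c * x ^ 4 + 2 * y₁ x * (12 * x - y₁ x)) / (x * (12 * x - y₁ x))) x)) →
      (y₂ 1 = 0 ∧ (∀ x ∈ Set.Ioc (0 : ℝ) 1, y₂ x < 12 * x) ∧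
        (∀ x ∈ Set.Ioc (0 : ℝ) 1,
          HasDerivAt y₂
            ((-18 * c * x ^ 4 + 2 * y₂ x * (12 * x - y₂ x)) / (x * (12 * x - y₂ x))) x)) →
      ∀ x ∈ Set.Ioc (0 : ℝ) 1, y₁ x = y₂ x) := by
  constructor
  · have hinj := (XX_anti c hc).injective
    have h0 : 0 < c := hc.1
    obtain ⟨b, hb, hJb⟩ := JJ_root c hc
    have hXb : XX c b = 0 := by simp [XX, hJb]
    set g := Function.invFun (XX c) with hg
    have hgX : ∀ u, g (XX c u) = u := Function.leftInverse_invFun hinj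
    have hXg : ∀ x ∈ Set.Ioc (0 : ℝ) 1, XX c (g x) = x := by
      intro x hx
      obtain ⟨u, _, hu⟩ := intermediate_value_Icc' hb.le (XX_cont c h0).continuousOn
        (show x ∈ Icc (XX c b) (XX c 0) by rw [hXb, XX_zero]; exact ⟨hx.1.le, hx.2⟩)
      rw [← hu, hgX]
    have hp : ∀ x ∈ Set.Ioc (0 : ℝ) 1, 0 < 12 - g x * x := by
      intro x hx
      have := p_pos c hc (g x)
      rwa [hXg x hx] at this
    refine ⟨fun x => x ^ 2 * g x, ?_, ?_, ?_⟩
    · have := hgX 0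
      rw [XX_zero] at this
      simp [this]
    · intro x hx
      have := mul_pos hx.1 (hp x hx)
      simp only
      nlinarith
    · intro x hx
      have hx0 : x ≠ 0 := hx.1.ne'
      have hpx := hp x hx
      have hs := XX_strict c h0 (g x)
      have hne : -((12 - g x * XX c (g x)) / (18 * c)) ≠ 0 := by
        rw [hXg x hx]
        exact neg_ne_zero.2 (by positivity)
      have hgd := (hs.to_local_left_inverse hne
        (Filter.Eventually.of_forall hgX)).hasDerivAt
      rw [hXg x hx] at hgd
      refine ((hasDerivAt_pow 2 x).mul hgd).congr_deriv ?_
      have e : 12 * x - x ^ 2 * g x = x * (12 - g x * x) := by ring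
      have hpn := hpx.ne'
      simp only [e]
      generalize 12 - g x * x = p at *
      field_simp
      norm_num
      try ring
  · rintro y₁ y₂ ⟨a1, a2, a3⟩ ⟨b1, b2, b3⟩ x hx
    have h1 := sol_eq c hc.1 y₁ a1 a2 a3 x hx
    have h2 := sol_eq c hc.1 y₂ b1 b2 b3 x hx
    have h := (XX_anti c hc).injective (h1.trans h2.symm)
    have hx0 : x ^ 2 ≠ 0 := pow_ne_zero 2 hx.1.ne'
    exact (div_left_inj' hx0).1 h
end

section
/- For a random interval I, the random variable x̄(I) has cumulative distribution function F given by F(t) = t² for 0 ≤ t < 1/2 and F(t) = 1 − (1−t)² for 1/2 ≤ t ≤ 1; that is, for every t ∈ [0,1], the Lebesgue measure of the set {(u,v) ∈ [0,1]² : min(max(min(u,v), 1/2), max(u,v)) ≤ t} equals t² if t < 1/2 and equals 1 − (1−t)² if t ≥ 1/2. -/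
open MeasureTheory

/-- The random variable `x̄(I)` of a random interval `I` has cumulative distribution
function `F(t) = t²` for `0 ≤ t < 1/2` and `F(t) = 1 − (1−t)²` for `1/2 ≤ t ≤ 1`:
for every `t ∈ [0,1]`, the Lebesgue measure of
`{(u,v) ∈ [0,1]² : min(max(min(u,v), 1/2), max(u,v)) ≤ t}` equals `t²` if `t < 1/2`
and `1 − (1−t)²` if `t ≥ 1/2`. -/
theorem stmt_5 :
    ∀ t : ℝ, t ∈ Set.Icc (0 : ℝ) 1 →
      volume {p : ℝ × ℝ | p.1 ∈ Set.Icc (0 : ℝ) 1 ∧ p.2 ∈ Set.Icc (0 : ℝ) 1 ∧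
          min (max (min p.1 p.2) (1 / 2)) (max p.1 p.2) ≤ t}
        = ENNReal.ofReal (if t < 1 / 2 then t ^ 2 else 1 - (1 - t) ^ 2) := by
  rintro t ⟨h0, h1⟩
  split_ifs with h
  · have : {p : ℝ × ℝ | p.1 ∈ Set.Icc (0 : ℝ) 1 ∧ p.2 ∈ Set.Icc (0 : ℝ) 1 ∧
          min (max (min p.1 p.2) (1 / 2)) (max p.1 p.2) ≤ t}
        = Set.Icc 0 t ×ˢ Set.Icc 0 t := by
      ext ⟨u, v⟩
      simp only [Set.mem_setOf_eq, Set.mem_prod, Set.mem_Icc, min_le_iff, max_le_iff]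
      grind
    rw [this, Measure.volume_eq_prod, Measure.prod_prod, Real.volume_Icc, sub_zero,
      ← ENNReal.ofReal_mul h0, sq]
  · have : {p : ℝ × ℝ | p.1 ∈ Set.Icc (0 : ℝ) 1 ∧ p.2 ∈ Set.Icc (0 : ℝ) 1 ∧
          min (max (min p.1 p.2) (1 / 2)) (max p.1 p.2) ≤ t}
        = (Set.Icc 0 1 ×ˢ Set.Icc 0 1) \ (Set.Ioc t 1 ×ˢ Set.Ioc t 1) := by
      ext ⟨u, v⟩
      simp only [Set.mem_setOf_eq, Set.mem_sdiff, Set.mem_prod, Set.mem_Icc, Set.mem_Ioc,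
        min_le_iff, max_le_iff]
      grind
    have h1' : 0 ≤ 1 - t := by linarith
    have hv : volume (Set.Ioc t 1 ×ˢ Set.Ioc t 1 : Set (ℝ × ℝ))
        = ENNReal.ofReal ((1 - t) ^ 2) := by
      rw [Measure.volume_eq_prod, Measure.prod_prod, Real.volume_Ioc,
        ← ENNReal.ofReal_mul h1', sq]
    rw [this, measure_diff _ (measurableSet_Ioc.prod measurableSet_Ioc).nullMeasurableSet, hv,
      Measure.volume_eq_prod, Measure.prod_prod, Real.volume_Icc,
      ENNReal.ofReal_sub _ (sq_nonneg _)]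
    · simp
    · rw [hv]; exact ENNReal.ofReal_ne_top
    · rintro ⟨u, v⟩
      simp only [Set.mem_prod, Set.mem_Icc, Set.mem_Ioc]
      grind
end

section
/- For a random interval I, the expectation of P = 1 − 2·x̄(I)·(1 − x̄(I)) equals 13/24; that is, ∫₀¹∫₀¹ (1 − 2·c(u,v)·(1 − c(u,v))) du dv = 13/24, where c(u,v) = min(max(min(u,v), 1/2), max(u,v)). -/
open MeasureTheory

theorem aux_FTC (p q r s a b : ℝ) :
    (∫ x in a..b, (p + q * x + r * x ^ 2 + s * x ^ 3)) =
      (p * b + q * b ^ 2 / 2 + r * b ^ 3 / 3 + s * b ^ 4 / 4)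
      - (p * a + q * a ^ 2 / 2 + r * a ^ 3 / 3 + s * a ^ 4 / 4) := by
  have h : ∀ x ∈ Set.uIcc a b, HasDerivAt
      (fun x : ℝ => p * x + q * x ^ 2 / 2 + r * x ^ 3 / 3 + s * x ^ 4 / 4)
      (p + q * x + r * x ^ 2 + s * x ^ 3) x := by
    intro x _
    have h1 := (hasDerivAt_id x).const_mul p
    have h2 := ((hasDerivAt_pow 2 x).const_mul q).div_const 2
    have h3 := ((hasDerivAt_pow 3 x).const_mul r).div_const 3
    have h4 := ((hasDerivAt_pow 4 x).const_mul s).div_const 4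
    have h5 := ((h1.add h2).add h3).add h4
    refine h5.congr_deriv ?_
    norm_num
    ring
  rw [intervalIntegral.integral_eq_sub_of_hasDerivAt h
    (Continuous.intervalIntegrable (by fun_prop) _ _)]

theorem aux_piece (f : ℝ → ℝ) (p q r s a b : ℝ) (hab : a ≤ b)
    (h : ∀ x, a ≤ x → x ≤ b → f x = p + q * x + r * x ^ 2 + s * x ^ 3) :
    (∫ x in a..b, f x) =
      (p * b + q * b ^ 2 / 2 + r * b ^ 3 / 3 + s * b ^ 4 / 4)
      - (p * a + q * a ^ 2 / 2 + r * a ^ 3 / 3 + s * a ^ 4 / 4) := by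
  rw [← aux_FTC]
  apply intervalIntegral.integral_congr
  intro x hx
  rw [Set.uIcc_of_le hab] at hx
  exact h x hx.1 hx.2

/-- The expectation of `P = 1 − 2·x̄(I)·(1 − x̄(I))` for a random interval `I` equals `13/24`:
`∫₀¹∫₀¹ (1 − 2·c(u,v)·(1 − c(u,v))) du dv = 13/24` where
`c(u,v) = min(max(min(u,v), 1/2), max(u,v))`. -/
theorem stmt_6
    (c : ℝ → ℝ → ℝ) (hc : ∀ u v : ℝ, c u v = min (max (min u v) (1 / 2)) (max u v)) :
    (∫ v in (0 : ℝ)..1, ∫ u in (0 : ℝ)..1, (1 - 2 * c u v * (1 - c u v))) = 13 / 24 := by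
  obtain rfl : c = fun u v => min (max (min u v) (1 / 2)) (max u v) := by
    funext u v; exact hc u v
  clear hc
  set F : ℝ → ℝ → ℝ := fun v u => 1 - 2 * (min (max (min u v) (1 / 2)) (max u v)) *
    (1 - (min (max (min u v) (1 / 2)) (max u v))) with hF
  have hi : ∀ v a b : ℝ, IntervalIntegrable (F v) volume a b := fun v a b =>
    Continuous.intervalIntegrable (by simp only [hF]; fun_prop) _ _
  have hcont : Continuous (fun v => ∫ u in (0 : ℝ)..1, F v u) := by
    apply intervalIntegral.continuous_parametric_intervalIntegral_of_continuous'
    simp only [hF, Function.uncurry_def]; fun_prop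
  change (∫ v in (0 : ℝ)..1, ∫ u in (0 : ℝ)..1, F v u) = 13 / 24
  have hlow : ∀ v : ℝ, 0 ≤ v → v ≤ 1 / 2 → (∫ u in (0 : ℝ)..1, F v u) =
      7 / 12 + 0 * v + (-1) * v ^ 2 + (4 / 3) * v ^ 3 := by
    intro v h0 h1
    rw [← intervalIntegral.integral_add_adjacent_intervals (hi v 0 v) (hi v v 1),
      ← intervalIntegral.integral_add_adjacent_intervals (hi v v (1 / 2)) (hi v (1 / 2) 1),
      aux_piece (F v) (1 - 2 * v * (1 - v)) 0 0 0 0 v h0,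
      aux_piece (F v) 1 (-2) 2 0 v (1 / 2) h1,
      aux_piece (F v) (1 / 2) 0 0 0 (1 / 2) 1 (by norm_num)]
    · ring
    · intro u h2 h3
      simp only [hF]
      rw [min_eq_right (by linarith : v ≤ u), max_eq_left (by linarith : v ≤ u),
        max_eq_right h1, min_eq_left h2]
      ring
    · intro u h2 h3
      simp only [hF]
      rw [min_eq_right h2, max_eq_left h2, max_eq_right h1, min_eq_right h3]
      ring
    · intro u h2 h3
      simp only [hF]
      rw [min_eq_left h3, max_eq_right h3, max_eq_right (by linarith), min_eq_right h1]
      ring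
  have hhigh : ∀ v : ℝ, 1 / 2 ≤ v → v ≤ 1 → (∫ u in (0 : ℝ)..1, F v u) =
      11 / 12 + (-2) * v + 3 * v ^ 2 + (-4 / 3) * v ^ 3 := by
    intro v h0 h1
    rw [← intervalIntegral.integral_add_adjacent_intervals (hi v 0 (1 / 2)) (hi v (1 / 2) 1),
      ← intervalIntegral.integral_add_adjacent_intervals (hi v (1 / 2) v) (hi v v 1),
      aux_piece (F v) (1 / 2) 0 0 0 0 (1 / 2) (by norm_num),
      aux_piece (F v) 1 (-2) 2 0 (1 / 2) v h0,
      aux_piece (F v) (1 - 2 * v * (1 - v)) 0 0 0 v 1 h1]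
    · ring
    · intro u h2 h3
      simp only [hF]
      rw [min_eq_right h2, max_eq_left h2, max_eq_left h0, min_eq_left h2]
      ring
    · intro u h2 h3
      simp only [hF]
      rw [min_eq_left h3, max_eq_right h3, max_eq_left h2, min_eq_left h3]
      ring
    · intro u h2 h3
      simp only [hF]
      rw [min_eq_left (by linarith : u ≤ v), max_eq_right (by linarith : u ≤ v),
        max_eq_right h3, min_eq_left h0]
      ring
  rw [← intervalIntegral.integral_add_adjacent_intervals
      (hcont.intervalIntegrable 0 (1 / 2)) (hcont.intervalIntegrable (1 / 2) 1),
    aux_piece _ _ _ _ _ 0 (1 / 2) (by norm_num) hlow,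
    aux_piece _ _ _ _ _ (1 / 2) 1 (by norm_num) hhigh]
  norm_num
end

section
/- For a random interval I, the second moment of P = 1 − 2·x̄(I)·(1 − x̄(I)) equals 3/10; that is, ∫₀¹∫₀¹ (1 − 2·c(u,v)·(1 − c(u,v)))² du dv = 3/10, where c(u,v) = min(max(min(u,v), 1/2), max(u,v)). -/
open MeasureTheory

lemma aux_int (a b : ℝ) : (∫ u in a..b, (1 - 2 * u * (1 - u)) ^ 2) =
    (b - 2*b^2 + 8/3*b^3 - 2*b^4 + 4/5*b^5) - (a - 2*a^2 + 8/3*a^3 - 2*a^4 + 4/5*a^5) := by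
  apply intervalIntegral.integral_eq_sub_of_hasDerivAt
    (f := fun x : ℝ => x - 2*x^2 + 8/3*x^3 - 2*x^4 + 4/5*x^5)
  · intro x _
    have h := ((((hasDerivAt_id x).sub ((hasDerivAt_pow 2 x).const_mul 2)).add
      ((hasDerivAt_pow 3 x).const_mul (8/3))).sub ((hasDerivAt_pow 4 x).const_mul 2)).add
      ((hasDerivAt_pow 5 x).const_mul (4/5))
    refine h.congr_deriv ?_
    norm_num
    ring
  · exact Continuous.intervalIntegrable (by fun_prop) _ _

lemma aux_poly (a b p0 p1 p2 p3 p4 p5 : ℝ) :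
    (∫ x in a..b, (p0 + p1*x + p2*x^2 + p3*x^3 + p4*x^4 + p5*x^5)) =
    (p0*b + p1/2*b^2 + p2/3*b^3 + p3/4*b^4 + p4/5*b^5 + p5/6*b^6)
    - (p0*a + p1/2*a^2 + p2/3*a^3 + p3/4*a^4 + p4/5*a^5 + p5/6*a^6) := by
  apply intervalIntegral.integral_eq_sub_of_hasDerivAt
    (f := fun x : ℝ => p0*x + p1/2*x^2 + p2/3*x^3 + p3/4*x^4 + p4/5*x^5 + p5/6*x^6)
  · intro x _
    have h := ((((((hasDerivAt_id x).const_mul p0).add ((hasDerivAt_pow 2 x).const_mul (p1/2))).add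
      ((hasDerivAt_pow 3 x).const_mul (p2/3))).add ((hasDerivAt_pow 4 x).const_mul (p3/4))).add
      ((hasDerivAt_pow 5 x).const_mul (p4/5))).add ((hasDerivAt_pow 6 x).const_mul (p5/6))
    refine h.congr_deriv ?_
    norm_num
    ring
  · exact Continuous.intervalIntegrable (by fun_prop) _ _

/-- The second moment of `P = 1 − 2·x̄(I)·(1 − x̄(I))` for a random interval `I` equals `3/10`:
`∫₀¹∫₀¹ (1 − 2·c(u,v)·(1 − c(u,v)))² du dv = 3/10` where
`c(u,v) = min(max(min(u,v), 1/2), max(u,v))`. -/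
theorem stmt_7
    (c : ℝ → ℝ → ℝ) (hc : ∀ u v : ℝ, c u v = min (max (min u v) (1 / 2)) (max u v)) :
    (∫ v in (0 : ℝ)..1, ∫ u in (0 : ℝ)..1, (1 - 2 * c u v * (1 - c u v)) ^ 2) = 3 / 10 := by
  have hcc : Continuous (fun p : ℝ × ℝ => c p.1 p.2) := by
    simp only [hc]; fun_prop
  have hcu : ∀ v, Continuous (fun u => c u v) := by
    intro v; simp only [hc]; fun_prop
  have hi : ∀ v a b : ℝ, IntervalIntegrable (fun u => (1 - 2 * c u v * (1 - c u v)) ^ 2)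
      volume a b := by
    intro v a b
    have := hcu v
    exact Continuous.intervalIntegrable (by fun_prop) _ _
  have hC : Continuous (fun v => ∫ u in (0 : ℝ)..1, (1 - 2 * c u v * (1 - c u v)) ^ 2) := by
    apply intervalIntegral.continuous_parametric_intervalIntegral_of_continuous'
    simp only [Function.uncurry_def, hc]
    fun_prop
  have key : ∀ (v a b : ℝ) (g : ℝ → ℝ), a ≤ b → (∀ u, a ≤ u → u ≤ b → c u v = g u) →
      (∫ u in a..b, (1 - 2 * c u v * (1 - c u v)) ^ 2) =
      ∫ u in a..b, (1 - 2 * g u * (1 - g u)) ^ 2 := by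
    intro v a b g hab h
    apply intervalIntegral.integral_congr
    intro u hu
    rw [Set.uIcc_of_le hab] at hu
    simp only [h u hu.1 hu.2]
  have h1 : ∀ v : ℝ, 0 ≤ v → v ≤ 1/2 →
      (∫ u in (0 : ℝ)..1, (1 - 2 * c u v * (1 - c u v)) ^ 2) =
      43/120 + 0*v + (-2)*v^2 + (16/3)*v^3 + (-6)*v^4 + (16/5)*v^5 := by
    intro v h0 hv
    rw [← intervalIntegral.integral_add_adjacent_intervals (hi v 0 v) (hi v v 1),
      ← intervalIntegral.integral_add_adjacent_intervals (hi v v (1/2)) (hi v (1/2) 1),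
      key v 0 v (fun _ => v) h0 (by intro u _ _; rw [hc]; grind),
      key v v (1/2) (fun u => u) hv (by intro u _ _; rw [hc]; grind),
      key v (1/2) 1 (fun _ => 1/2) (by norm_num) (by intro u _ _; rw [hc]; grind),
      aux_int, intervalIntegral.integral_const, intervalIntegral.integral_const]
    simp only [smul_eq_mul]
    ring
  have h2 : ∀ v : ℝ, 1/2 ≤ v → v ≤ 1 →
      (∫ u in (0 : ℝ)..1, (1 - 2 * c u v * (1 - c u v)) ^ 2) =
      107/120 + (-4)*v + 10*v^2 + (-40/3)*v^3 + 10*v^4 + (-16/5)*v^5 := by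
    intro v h0 hv
    rw [← intervalIntegral.integral_add_adjacent_intervals (hi v 0 (1/2)) (hi v (1/2) 1),
      ← intervalIntegral.integral_add_adjacent_intervals (hi v (1/2) v) (hi v v 1),
      key v 0 (1/2) (fun _ => 1/2) (by norm_num) (by intro u _ _; rw [hc]; grind),
      key v (1/2) v (fun u => u) h0 (by intro u _ _; rw [hc]; grind),
      key v v 1 (fun _ => v) hv (by intro u _ _; rw [hc]; grind),
      aux_int, intervalIntegral.integral_const, intervalIntegral.integral_const]
    simp only [smul_eq_mul]
    ring
  rw [← intervalIntegral.integral_add_adjacent_intervals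
    (hC.intervalIntegrable 0 (1/2)) (hC.intervalIntegrable (1/2) 1)]
  have e1 : (∫ v in (0:ℝ)..(1/2), ∫ u in (0 : ℝ)..1, (1 - 2 * c u v * (1 - c u v)) ^ 2) =
      ∫ v in (0:ℝ)..(1/2),
        (43/120 + 0*v + (-2)*v^2 + (16/3)*v^3 + (-6)*v^4 + (16/5)*v^5) := by
    apply intervalIntegral.integral_congr
    intro v hv
    rw [Set.uIcc_of_le (by norm_num)] at hv
    exact h1 v hv.1 hv.2
  have e2 : (∫ v in (1/2:ℝ)..1, ∫ u in (0 : ℝ)..1, (1 - 2 * c u v * (1 - c u v)) ^ 2) =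
      ∫ v in (1/2:ℝ)..1,
        (107/120 + (-4)*v + 10*v^2 + (-40/3)*v^3 + 10*v^4 + (-16/5)*v^5) := by
    apply intervalIntegral.integral_congr
    intro v hv
    rw [Set.uIcc_of_le (by norm_num)] at hv
    exact h2 v hv.1 hv.2
  rw [e1, e2, aux_poly, aux_poly]
  norm_num
end

section
/- For two independent random intervals I and J, the probability that x̄(I) ∈ J equals 11/24; that is, the Lebesgue measure of the set {(u,v,s,t) ∈ [0,1]⁴ : min(s,t) ≤ c(u,v) ≤ max(s,t)}, where c(u,v) = min(max(min(u,v), 1/2), max(u,v)), equals 11/24. -/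
open MeasureTheory

lemma aux_slice (x : ℝ) (h0 : 0 ≤ x) (h1 : x ≤ 1) :
    volume {p : ℝ × ℝ | p.1 ∈ Set.Icc (0 : ℝ) 1 ∧ p.2 ∈ Set.Icc (0 : ℝ) 1 ∧
      min p.1 p.2 ≤ x ∧ x ≤ max p.1 p.2} = ENNReal.ofReal (2 * x * (1 - x)) := by
  have hS : {p : ℝ × ℝ | p.1 ∈ Set.Icc (0 : ℝ) 1 ∧ p.2 ∈ Set.Icc (0 : ℝ) 1 ∧
      min p.1 p.2 ≤ x ∧ x ≤ max p.1 p.2} =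
      (Set.Icc 0 x ×ˢ Set.Icc x 1) ∪ (Set.Icc x 1 ×ˢ Set.Icc 0 x) := by
    ext ⟨s, t⟩
    simp only [Set.mem_setOf_eq, Set.mem_union, Set.mem_prod, Set.mem_Icc, min_le_iff, le_max_iff]
    constructor
    · rintro ⟨⟨a, b⟩, ⟨d, e⟩, f, g⟩
      rcases le_total s x with h | h <;> rcases le_total t x with h' | h' <;>
        rcases f with f | f <;> rcases g with g | g <;>
        first
        | (left; refine ⟨⟨?_, ?_⟩, ?_, ?_⟩ <;> linarith)
        | (right; refine ⟨⟨?_, ?_⟩, ?_, ?_⟩ <;> linarith)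
    · rintro (⟨⟨a, b⟩, d, e⟩ | ⟨⟨a, b⟩, d, e⟩)
      · exact ⟨⟨a, by linarith⟩, ⟨by linarith, e⟩, Or.inl b, Or.inr d⟩
      · exact ⟨⟨by linarith, b⟩, ⟨d, by linarith⟩, Or.inr e, Or.inl a⟩
  have hd : AEDisjoint (volume : Measure (ℝ × ℝ)) (Set.Icc 0 x ×ˢ Set.Icc x 1)
      (Set.Icc x 1 ×ˢ Set.Icc 0 x) := by
    have : (Set.Icc 0 x ×ˢ Set.Icc x 1) ∩ (Set.Icc x 1 ×ˢ Set.Icc 0 x) ⊆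
        ({x} : Set ℝ) ×ˢ ({x} : Set ℝ) := by
      rintro ⟨s, t⟩ ⟨⟨a, b⟩, d, e⟩
      simp only [Set.mem_Icc] at a b d e
      exact ⟨le_antisymm a.2 d.1, le_antisymm e.2 b.1⟩
    refine measure_mono_null this ?_
    rw [Measure.volume_eq_prod, Measure.prod_prod]
    simp
  rw [hS, measure_union₀ (measurableSet_Icc.prod measurableSet_Icc).nullMeasurableSet hd,
    Measure.volume_eq_prod, Measure.prod_prod, Measure.prod_prod]
  simp only [Real.volume_Icc]
  rw [← ENNReal.ofReal_mul (by linarith), ← ENNReal.ofReal_mul (by linarith),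
    ← ENNReal.ofReal_add (by nlinarith) (by nlinarith)]
  congr 1; ring

/-- center -/
noncomputable def cc (u v : ℝ) : ℝ := min (max (min u v) (1 / 2)) (max u v)

lemma cc_cont : Continuous (fun p : ℝ × ℝ => cc p.1 p.2) := by
  unfold cc; fun_prop

/-- integrand -/
noncomputable def gg (u v : ℝ) : ℝ := 2 * cc u v * (1 - cc u v)

lemma gg_cont : Continuous (fun p : ℝ × ℝ => gg p.1 p.2) := by
  unfold gg
  have := cc_cont
  fun_prop

lemma gg_cont' (u : ℝ) : Continuous (gg u) :=
  gg_cont.comp (by fun_prop : Continuous (fun v : ℝ => (u, v)))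

lemma cc_mem {u v : ℝ} (hu : u ∈ Set.Icc (0 : ℝ) 1) (hv : v ∈ Set.Icc (0 : ℝ) 1) :
    0 ≤ cc u v ∧ cc u v ≤ 1 := by
  unfold cc
  exact ⟨le_min (le_max_of_le_right (by norm_num)) (le_max_of_le_left hu.1),
    min_le_of_right_le (max_le hu.2 hv.2)⟩

lemma gg_nonneg {u v : ℝ} (hu : u ∈ Set.Icc (0 : ℝ) 1) (hv : v ∈ Set.Icc (0 : ℝ) 1) :
    0 ≤ gg u v := by
  have := cc_mem hu hv
  unfold gg
  exact mul_nonneg (by linarith) (by linarith)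

lemma int_quad (a b : ℝ) : ∫ v in a..b, 2 * v * (1 - v) =
    (b ^ 2 - 2 / 3 * b ^ 3) - (a ^ 2 - 2 / 3 * a ^ 3) := by
  rw [intervalIntegral.integral_eq_sub_of_hasDerivAt (f := fun v => v ^ 2 - 2 / 3 * v ^ 3)]
  · intro x _
    refine HasDerivAt.congr_deriv ((hasDerivAt_pow 2 x).sub ((hasDerivAt_pow 3 x).const_mul (2 / 3))) ?_
    push_cast; ring
  · exact Continuous.intervalIntegrable (by fun_prop) _ _

lemma inner_lo {u : ℝ} (h0 : 0 ≤ u) (h1 : u ≤ 1 / 2) :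
    ∫ v in (0 : ℝ)..1, gg u v = 5 / 12 + u ^ 2 - 4 / 3 * u ^ 3 := by
  have hI : ∀ a b, IntervalIntegrable (gg u) volume a b :=
    fun a b => (gg_cont' u).intervalIntegrable a b
  rw [← intervalIntegral.integral_add_adjacent_intervals (hI 0 u) (hI u 1),
    ← intervalIntegral.integral_add_adjacent_intervals (hI u (1 / 2)) (hI (1 / 2) 1)]
  have e1 : ∫ v in (0 : ℝ)..u, gg u v = ∫ v in (0 : ℝ)..u, 2 * u * (1 - u) := by
    apply intervalIntegral.integral_congr
    intro v hv
    rw [Set.uIcc_of_le h0] at hv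
    have : cc u v = u := by
      unfold cc
      rw [min_eq_right hv.2, max_eq_right (by linarith [hv.2]), max_eq_left hv.2, min_eq_right h1]
    simp only [gg, this]
  have e2 : ∫ v in u..(1 / 2), gg u v = ∫ v in u..(1 / 2), 2 * v * (1 - v) := by
    apply intervalIntegral.integral_congr
    intro v hv
    rw [Set.uIcc_of_le h1] at hv
    have : cc u v = v := by
      unfold cc
      rw [min_eq_left hv.1, max_eq_right h1, max_eq_right hv.1, min_eq_right hv.2]
    simp only [gg, this]
  have e3 : ∫ v in (1 / 2 : ℝ)..1, gg u v = ∫ v in (1 / 2 : ℝ)..1, (1 / 2 : ℝ) := by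
    apply intervalIntegral.integral_congr
    intro v hv
    rw [Set.uIcc_of_le (by norm_num)] at hv
    have : cc u v = 1 / 2 := by
      unfold cc
      rw [min_eq_left (h1.trans hv.1), max_eq_right h1, max_eq_right (h1.trans hv.1),
        min_eq_left hv.1]
    simp only [gg, this]; norm_num
  rw [e1, e2, e3, int_quad]
  simp only [intervalIntegral.integral_const, smul_eq_mul]
  ring

lemma inner_hi {u : ℝ} (h0 : 1 / 2 ≤ u) (h1 : u ≤ 1) :
    ∫ v in (0 : ℝ)..1, gg u v = 1 / 12 + 2 * u - 3 * u ^ 2 + 4 / 3 * u ^ 3 := by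
  have hI : ∀ a b, IntervalIntegrable (gg u) volume a b :=
    fun a b => (gg_cont' u).intervalIntegrable a b
  rw [← intervalIntegral.integral_add_adjacent_intervals (hI 0 (1 / 2)) (hI (1 / 2) 1),
    ← intervalIntegral.integral_add_adjacent_intervals (hI (1 / 2) u) (hI u 1)]
  have e1 : ∫ v in (0 : ℝ)..(1 / 2), gg u v = ∫ v in (0 : ℝ)..(1 / 2), (1 / 2 : ℝ) := by
    apply intervalIntegral.integral_congr
    intro v hv
    rw [Set.uIcc_of_le (by norm_num)] at hv
    have : cc u v = 1 / 2 := by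
      unfold cc
      rw [min_eq_right (hv.2.trans h0), max_eq_right hv.2, max_eq_left (hv.2.trans h0),
        min_eq_left h0]
    simp only [gg, this]; norm_num
  have e2 : ∫ v in (1 / 2)..u, gg u v = ∫ v in (1 / 2)..u, 2 * v * (1 - v) := by
    apply intervalIntegral.integral_congr
    intro v hv
    rw [Set.uIcc_of_le h0] at hv
    have : cc u v = v := by
      unfold cc
      rw [min_eq_right hv.2, max_eq_left hv.1, max_eq_left hv.2, min_eq_left hv.2]
    simp only [gg, this]
  have e3 : ∫ v in u..1, gg u v = ∫ v in u..1, 2 * u * (1 - u) := by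
    apply intervalIntegral.integral_congr
    intro v hv
    rw [Set.uIcc_of_le h1] at hv
    have : cc u v = u := by
      unfold cc
      rw [min_eq_left hv.1, max_eq_left h0, max_eq_right hv.1, min_eq_left hv.1]
    simp only [gg, this]
  rw [e1, e2, e3, int_quad]
  simp only [intervalIntegral.integral_const, smul_eq_mul]
  ring

lemma lint_to_int {f : ℝ → ℝ} (hf : ContinuousOn f (Set.Icc 0 1))
    (h : ∀ v ∈ Set.Icc (0 : ℝ) 1, 0 ≤ f v) :
    ∫⁻ v in Set.Icc (0 : ℝ) 1, ENNReal.ofReal (f v) =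
      ENNReal.ofReal (∫ v in (0 : ℝ)..1, f v) := by
  rw [intervalIntegral.integral_of_le zero_le_one, ← integral_Icc_eq_integral_Ioc,
    ofReal_integral_eq_lintegral_ofReal hf.integrableOn_Icc]
  exact (ae_restrict_iff' measurableSet_Icc).2 (Filter.Eventually.of_forall h)

lemma outer_cont : Continuous (fun u => ∫ v in (0 : ℝ)..1, gg u v) :=
  intervalIntegral.continuous_parametric_intervalIntegral_of_continuous' gg_cont 0 1

lemma int_poly (k a b d : ℝ) (x y : ℝ) :
    ∫ u in x..y, (k + a * u + b * u ^ 2 + d * u ^ 3) =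
    (k * y + a / 2 * y ^ 2 + b / 3 * y ^ 3 + d / 4 * y ^ 4) -
    (k * x + a / 2 * x ^ 2 + b / 3 * x ^ 3 + d / 4 * x ^ 4) := by
  rw [intervalIntegral.integral_eq_sub_of_hasDerivAt
    (f := fun y => k * y + a / 2 * y ^ 2 + b / 3 * y ^ 3 + d / 4 * y ^ 4)]
  · intro x _
    refine HasDerivAt.congr_deriv (((((hasDerivAt_id x).const_mul k).add ((hasDerivAt_pow 2 x).const_mul (a / 2))).add
      ((hasDerivAt_pow 3 x).const_mul (b / 3))).add
      ((hasDerivAt_pow 4 x).const_mul (d / 4))) ?_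
    push_cast; ring
  · exact Continuous.intervalIntegrable (by fun_prop) _ _

lemma outer_int : ∫ u in (0 : ℝ)..1, ∫ v in (0 : ℝ)..1, gg u v = 11 / 24 := by
  rw [← intervalIntegral.integral_add_adjacent_intervals
    (outer_cont.intervalIntegrable 0 (1 / 2)) (outer_cont.intervalIntegrable (1 / 2) 1)]
  have e1 : ∫ u in (0 : ℝ)..(1 / 2), ∫ v in (0 : ℝ)..1, gg u v =
      ∫ u in (0 : ℝ)..(1 / 2), (5 / 12 + 0 * u + 1 * u ^ 2 + (-4 / 3) * u ^ 3) := by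
    apply intervalIntegral.integral_congr
    intro u hu
    rw [Set.uIcc_of_le (by norm_num)] at hu
    simp only [inner_lo hu.1 hu.2]; ring
  have e2 : ∫ u in (1 / 2 : ℝ)..1, ∫ v in (0 : ℝ)..1, gg u v =
      ∫ u in (1 / 2 : ℝ)..1, (1 / 12 + 2 * u + (-3) * u ^ 2 + (4 / 3) * u ^ 3) := by
    apply intervalIntegral.integral_congr
    intro u hu
    rw [Set.uIcc_of_le (by norm_num)] at hu
    simp only [inner_hi hu.1 hu.2]; ring
  rw [e1, e2, int_poly, int_poly]
  norm_num

/-- For two independent random intervals `I` and `J`, the probability that `x̄(I) ∈ J`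
equals `11/24`: the Lebesgue measure of
`{(u,v,s,t) ∈ [0,1]⁴ : min(s,t) ≤ c(u,v) ≤ max(s,t)}`, where
`c(u,v) = min(max(min(u,v), 1/2), max(u,v))`, equals `11/24`. -/
theorem stmt_8
    (c : ℝ → ℝ → ℝ) (hc : ∀ u v : ℝ, c u v = min (max (min u v) (1 / 2)) (max u v)) :
    volume {q : ℝ × ℝ × ℝ × ℝ |
        q.1 ∈ Set.Icc (0 : ℝ) 1 ∧ q.2.1 ∈ Set.Icc (0 : ℝ) 1 ∧
        q.2.2.1 ∈ Set.Icc (0 : ℝ) 1 ∧ q.2.2.2 ∈ Set.Icc (0 : ℝ) 1 ∧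
        min q.2.2.1 q.2.2.2 ≤ c q.1 q.2.1 ∧ c q.1 q.2.1 ≤ max q.2.2.1 q.2.2.2}
      = 11 / 24 := by
  have hcc : c = cc := by
    funext u v; exact hc u v
  subst hcc
  have hm : MeasurableSet {q : ℝ × ℝ × ℝ × ℝ |
        q.1 ∈ Set.Icc (0 : ℝ) 1 ∧ q.2.1 ∈ Set.Icc (0 : ℝ) 1 ∧
        q.2.2.1 ∈ Set.Icc (0 : ℝ) 1 ∧ q.2.2.2 ∈ Set.Icc (0 : ℝ) 1 ∧
        min q.2.2.1 q.2.2.2 ≤ cc q.1 q.2.1 ∧ cc q.1 q.2.1 ≤ max q.2.2.1 q.2.2.2} := by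
    have h1 : Continuous (fun q : ℝ × ℝ × ℝ × ℝ => cc q.1 q.2.1) :=
      cc_cont.comp (by fun_prop : Continuous (fun q : ℝ × ℝ × ℝ × ℝ => (q.1, q.2.1)))
    apply IsClosed.measurableSet
    refine (isClosed_Icc.preimage (by fun_prop)).inter
      ((isClosed_Icc.preimage (f := fun q : ℝ × ℝ × ℝ × ℝ => q.2.1) (by fun_prop)).inter
      ((isClosed_Icc.preimage (f := fun q : ℝ × ℝ × ℝ × ℝ => q.2.2.1) (by fun_prop)).inter
      ((isClosed_Icc.preimage (f := fun q : ℝ × ℝ × ℝ × ℝ => q.2.2.2) (by fun_prop)).inter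
      ((isClosed_le (by fun_prop) h1).inter (isClosed_le h1 (by fun_prop))))))
  rw [Measure.volume_eq_prod, Measure.prod_apply hm]
  have key : ∀ u : ℝ, volume (Prod.mk u ⁻¹' {q : ℝ × ℝ × ℝ × ℝ |
        q.1 ∈ Set.Icc (0 : ℝ) 1 ∧ q.2.1 ∈ Set.Icc (0 : ℝ) 1 ∧
        q.2.2.1 ∈ Set.Icc (0 : ℝ) 1 ∧ q.2.2.2 ∈ Set.Icc (0 : ℝ) 1 ∧
        min q.2.2.1 q.2.2.2 ≤ cc q.1 q.2.1 ∧ cc q.1 q.2.1 ≤ max q.2.2.1 q.2.2.2}) =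
      (Set.Icc (0 : ℝ) 1).indicator
        (fun u => ENNReal.ofReal (∫ v in (0 : ℝ)..1, gg u v)) u := by
    intro u
    by_cases hu : u ∈ Set.Icc (0 : ℝ) 1
    · rw [Set.indicator_of_mem hu, Measure.volume_eq_prod,
        Measure.prod_apply (measurable_prodMk_left hm),
        ← lint_to_int (gg_cont' u).continuousOn (fun v hv => gg_nonneg hu hv),
        ← lintegral_indicator measurableSet_Icc]
      congr 1
      funext v
      by_cases hv : v ∈ Set.Icc (0 : ℝ) 1
      · rw [Set.indicator_of_mem hv, gg, ← aux_slice _ (cc_mem hu hv).1 (cc_mem hu hv).2]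
        congr 1
        ext p
        simp only [Set.mem_preimage, Set.mem_setOf_eq, hu, hv, true_and]
      · rw [Set.indicator_of_notMem hv]
        convert measure_empty (μ := (volume : Measure (ℝ × ℝ)))
        ext p
        simp only [Set.mem_preimage, Set.mem_setOf_eq, hv, false_and, and_false,
          Set.mem_empty_iff_false]
    · rw [Set.indicator_of_notMem hu]
      convert measure_empty (μ := (volume : Measure (ℝ × ℝ × ℝ)))
      ext p
      simp only [Set.mem_preimage, Set.mem_setOf_eq, hu, false_and, Set.mem_empty_iff_false]
  rw [lintegral_congr key, lintegral_indicator measurableSet_Icc,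
    lint_to_int outer_cont.continuousOn, outer_int]
  · rw [ENNReal.ofReal_div_of_pos (by norm_num)]
    norm_num
  · intro u hu
    exact intervalIntegral.integral_nonneg zero_le_one (fun v hv => gg_nonneg hu hv)
end
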